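/- Let h(u,v) = \sum_{i=0}^{12} \binom{12}{i} \alpha_i u^i v^{12-i} with (\alpha_0, \dots, \alpha_{12}) = (-81, -27, -27, -27, -9, 9, 171/7, 33, 63, 141, 149, -67, -1657). Define g = (1/132^2)(h_{uu} h_{vv} - h_{uv}^2) and f = (1/240)(h_u g_v - h_v g_u), where subscripts denote partial derivatives with respect to u and v; then f is a binary form of degree 30 with integer coefficients. There are no integers u, v, y with (u, v) \neq (0, 0) and y^2 = -f(u, v). -/

import Mathlib

open MvPolynomial

/-- The coefficient vector `(α₀, …, α₁₂)`. -/
noncomputable def alphaC41 : Fin 13 → ℚ := ![-81, -27, -27, -27, -9, 9, 171/7, 33, 63, 141, 149, -67, -1657]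

/-- The binary form `h(u,v) = ∑ i, (12 choose i) αᵢ uⁱ v^(12-i)`,
as a polynomial in the two variables `X 0 = u` and `X 1 = v`. -/
noncomputable def hC41 : MvPolynomial (Fin 2) ℚ :=
  ∑ i : Fin 13, C ((Nat.choose 12 i : ℚ) * alphaC41 i) * X 0 ^ (i : ℕ) * X 1 ^ (12 - (i : ℕ))

/-- `g = (1/132²)·(h_uu h_vv - h_uv²)`. -/
noncomputable def gC41 : MvPolynomial (Fin 2) ℚ :=
  C ((1 : ℚ) / 132 ^ 2) *
    (pderiv 0 (pderiv 0 hC41) * pderiv 1 (pderiv 1 hC41) -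
      pderiv 1 (pderiv 0 hC41) * pderiv 1 (pderiv 0 hC41))

/-- `f = (1/240)·(h_u g_v - h_v g_u)`. -/
noncomputable def fC41 : MvPolynomial (Fin 2) ℚ :=
  C ((1 : ℚ) / 240) *
    (pderiv 0 hC41 * pderiv 1 gC41 - pderiv 1 hC41 * pderiv 0 gC41)

namespace C41

/-- Coordinate vectors with respect to `1, θ, θ², θ³/3, θ⁴/3`. -/
abbrev V := ℤ × ℤ × ℤ × ℤ × ℤ

/-- Multiplication of coordinate vectors. -/
def mulv : V → V → V
  | (a0, a1, a2, a3, a4), (b0, b1, b2, b3, b4) =>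
    (a0*b0 + 6*(a1*b4+a4*b1) + 6*(a2*b3+a3*b2) + 60*(a4*b4),
     a0*b1+a1*b0 - 15*(a1*b4+a4*b1) - 15*(a2*b3+a3*b2) + 6*(a2*b4+a4*b2) + 2*(a3*b3) - 150*(a4*b4),
     a0*b2+a2*b0 + a1*b1 + 10*(a1*b4+a4*b1) + 10*(a2*b3+a3*b2) - 15*(a2*b4+a4*b2) - 5*(a3*b3)
       + 2*(a3*b4+a4*b3) + 100*(a4*b4),
     a0*b3+a3*b0 + 3*(a1*b2+a2*b1) + 30*(a2*b4+a4*b2) + 10*(a3*b3) - 15*(a3*b4+a4*b3) + 6*(a4*b4),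
     a0*b4+a4*b0 + (a1*b3+a3*b1) + 3*(a2*b2) + 10*(a3*b4+a4*b3) - 15*(a4*b4))

/-- Coordinates. -/
def co : V → Fin 5 → ℤ
  | (a0, a1, a2, a3, a4) => ![a0, a1, a2, a3, a4]

/-- Unit vectors. -/
def ev5 : Fin 5 → V := ![(1,0,0,0,0), (0,1,0,0,0), (0,0,1,0,0), (0,0,0,1,0), (0,0,0,0,1)]

/-- Multiplication matrix. -/
def matv (a : V) : Matrix (Fin 5) (Fin 5) ℤ := Matrix.of fun i j => co (mulv a (ev5 j)) i

/-- The quintic field data. -/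
structure Dat (K : Type) [Field K] [NumberField K] where
  θ : K
  h5 : θ ^ 5 = 30 * θ ^ 2 - 45 * θ + 18
  b : Module.Basis (Fin 5) ℚ K
  hb : ∀ i, b i = ![1, θ, θ ^ 2, θ ^ 3 / 3, θ ^ 4 / 3] i

section
variable {K : Type} [Field K] [NumberField K] (D : Dat K)

/-- The element of `K` with given coordinates. -/
def Dat.phiK : V → K
  | (a0, a1, a2, a3, a4) => a0 + a1 * D.θ + a2 * D.θ ^ 2 + a3 * (D.θ ^ 3 / 3) + a4 * (D.θ ^ 4 / 3)

lemma Dat.phiK_eq_sum (a : V) : D.phiK a = ∑ i, ((co a i : ℤ) : ℚ) • D.b i := by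
  obtain ⟨a0, a1, a2, a3, a4⟩ := a
  simp [Fin.sum_univ_succ, D.hb, co, Dat.phiK, Algebra.smul_def]
  ring

lemma Dat.repr_phiK (a : V) (i : Fin 5) : D.b.repr (D.phiK a) i = (co a i : ℤ) := by
  rw [D.phiK_eq_sum, D.b.repr_sum_self]

lemma Dat.phiK_mul (a b : V) : D.phiK (mulv a b) = D.phiK a * D.phiK b := by
  obtain ⟨a0, a1, a2, a3, a4⟩ := a
  obtain ⟨b0, b1, b2, b3, b4⟩ := b
  simp only [mulv, Dat.phiK]
  push_cast
  have h := D.h5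
  generalize D.θ = t at *
  have h6 : t ^ 6 = 30 * t ^ 3 - 45 * t ^ 2 + 18 * t := by linear_combination t * h
  have h7 : t ^ 7 = 30 * t ^ 4 - 45 * t ^ 3 + 18 * t ^ 2 := by linear_combination t ^ 2 * h
  have h8 : t ^ 8 = 30 * (30 * t ^ 2 - 45 * t + 18) - 45 * t ^ 4 + 18 * t ^ 3 := by
    linear_combination t ^ 3 * h + 30 * h
  linear_combination (-((a1:K) * b4 + a4 * b1 + a2 * b3 + a3 * b2) / 3) * h
    - ((a2:K) * b4 + a4 * b2) / 3 * h6 - (a3:K) * b3 / 9 * h6 - ((a3:K) * b4 + a4 * b3) / 9 * h7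
    - (a4:K) * b4 / 9 * h8

lemma Dat.phiK_inj {a b : V} (h : D.phiK a = D.phiK b) : a = b := by
  have : ∀ i, co a i = co b i := fun i => by
    have h1 := D.repr_phiK a i
    rw [h, D.repr_phiK b i] at h1
    exact_mod_cast h1.symm
  obtain ⟨a0, a1, a2, a3, a4⟩ := a
  obtain ⟨b0, b1, b2, b3, b4⟩ := b
  have e0 := this 0; have e1 := this 1; have e2 := this 2; have e3 := this 3; have e4 := this 4
  simp [co] at e0 e1 e2 e3 e4
  simp [*]

lemma Dat.b_eq (j : Fin 5) : D.b j = D.phiK (ev5 j) := by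
  rw [D.hb]
  fin_cases j <;> simp [ev5, Dat.phiK]

lemma Dat.leftMul (a : V) :
    Algebra.leftMulMatrix D.b (D.phiK a) = (matv a).map (Int.castRingHom ℚ) := by
  ext i j
  rw [Algebra.leftMulMatrix_eq_repr_mul, D.b_eq, ← D.phiK_mul, D.repr_phiK]
  simp [matv]

lemma Dat.normK (a : V) : Algebra.norm ℚ (D.phiK a) = ((matv a).det : ℤ) := by
  rw [Algebra.norm_eq_matrix_det D.b, D.leftMul]
  exact ((Int.castRingHom ℚ).map_det (matv a)).symm

lemma Dat.traceK (a : V) :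
    Algebra.trace ℚ K (D.phiK a) = ((5 * a.1 + 30 * a.2.2.2.1 - 60 * a.2.2.2.2 : ℤ) : ℚ) := by
  rw [Algebra.trace_eq_matrix_trace D.b, D.leftMul]
  obtain ⟨a0, a1, a2, a3, a4⟩ := a
  simp [Matrix.trace, Fin.sum_univ_succ, matv, mulv, ev5, co]
  ring

lemma Dat.int_theta : IsIntegral ℤ D.θ := by
  refine ⟨Polynomial.X ^ 5 - 30 * Polynomial.X ^ 2 + 45 * Polynomial.X - 18, ?_, ?_⟩
  · monicity!
  · simp only [Polynomial.eval₂_sub, Polynomial.eval₂_add, Polynomial.eval₂_mul, Polynomial.eval₂_pow,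
      Polynomial.eval₂_X, Polynomial.eval₂_ofNat]
    linear_combination D.h5

lemma Dat.int_w3 : IsIntegral ℤ (D.θ ^ 3 / 3) := by
  have e1 : D.θ ^ 3 / 3 = D.phiK (0,0,0,1,0) := by simp [Dat.phiK]
  have e2 : (D.θ ^ 3 / 3) ^ 2 = D.phiK (mulv (0,0,0,1,0) (0,0,0,1,0)) := by
    rw [D.phiK_mul, ← e1]; ring
  have e3 : (D.θ ^ 3 / 3) ^ 3 = D.phiK (mulv (0,0,0,1,0) (mulv (0,0,0,1,0) (0,0,0,1,0))) := by
    rw [D.phiK_mul, ← e2, ← e1]; ring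
  have e4 : (D.θ ^ 3 / 3) ^ 4 = D.phiK (mulv (0,0,0,1,0) (mulv (0,0,0,1,0)
      (mulv (0,0,0,1,0) (0,0,0,1,0)))) := by
    rw [D.phiK_mul, ← e3, ← e1]; ring
  have e5 : (D.θ ^ 3 / 3) ^ 5 = D.phiK (mulv (0,0,0,1,0) (mulv (0,0,0,1,0) (mulv (0,0,0,1,0)
      (mulv (0,0,0,1,0) (0,0,0,1,0))))) := by
    rw [D.phiK_mul, ← e4, ← e1]; ring
  refine ⟨Polynomial.X ^ 5 - 30 * Polynomial.X ^ 4 + 300 * Polynomial.X ^ 3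
    - 910 * Polynomial.X ^ 2 + 225 * Polynomial.X - 24, ?_, ?_⟩
  · monicity!
  · simp only [Polynomial.eval₂_sub, Polynomial.eval₂_add, Polynomial.eval₂_mul,
      Polynomial.eval₂_pow, Polynomial.eval₂_X, Polynomial.eval₂_ofNat]
    rw [e5, e4, e3, e2]
    simp only [mulv, Dat.phiK]
    push_cast
    ring

lemma Dat.int_phiK (a : V) : IsIntegral ℤ (D.phiK a) := by
  obtain ⟨a0, a1, a2, a3, a4⟩ := a
  have h4 : IsIntegral ℤ (D.θ ^ 4 / 3) := by
    have := D.int_theta.mul D.int_w3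
    have e : D.θ ^ 4 / 3 = D.θ * (D.θ ^ 3 / 3) := by ring
    rwa [e]
  have hc : ∀ n : ℤ, IsIntegral ℤ (n : K) := fun n => isIntegral_algebraMap (R := ℤ) (A := K) (x := n)
  exact ((((hc a0).add ((hc a1).mul D.int_theta)).add ((hc a2).mul (D.int_theta.pow 2))).add
    ((hc a3).mul D.int_w3)).add ((hc a4).mul h4)

open NumberField

/-- The integer of `K` with given coordinates. -/
def Dat.phi (a : V) : 𝓞 K := ⟨D.phiK a, D.int_phiK a⟩

@[simp] lemma Dat.coe_phi (a : V) : ((D.phi a : 𝓞 K) : K) = D.phiK a := rfl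

lemma Dat.phi_inj {a b : V} (h : D.phi a = D.phi b) : a = b :=
  D.phiK_inj (congrArg (fun x : 𝓞 K => (x : K)) h)

lemma Dat.phi_mul (a b : V) : D.phi (mulv a b) = D.phi a * D.phi b :=
  RingOfIntegers.ext (D.phiK_mul a b)

lemma Dat.phi_add (a b : V) : D.phi (a + b) = D.phi a + D.phi b := by
  apply RingOfIntegers.ext
  obtain ⟨a0, a1, a2, a3, a4⟩ := a
  obtain ⟨b0, b1, b2, b3, b4⟩ := b
  simp [Dat.phiK]
  ring

lemma Dat.phi_int (n : ℤ) : D.phi (n, 0, 0, 0, 0) = (n : 𝓞 K) := by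
  apply RingOfIntegers.ext
  simp [Dat.phiK]

lemma Dat.phi_smul (n : ℤ) (a : V) : D.phi (n • a) = (n : 𝓞 K) * D.phi a := by
  apply RingOfIntegers.ext
  obtain ⟨a0, a1, a2, a3, a4⟩ := a
  simp [Dat.phiK]
  ring

lemma Dat.phi_neg (a : V) : D.phi (-a) = - D.phi a := by
  have := D.phi_smul (-1) a
  simpa using this

lemma Dat.phi_sub (a b : V) : D.phi (a - b) = D.phi a - D.phi b := by
  rw [sub_eq_add_neg, D.phi_add, D.phi_neg, ← sub_eq_add_neg]

lemma Dat.phi_zero : D.phi 0 = 0 := by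
  have := D.phi_int 0
  rw [Int.cast_zero] at this
  exact this

lemma Dat.phi_one : D.phi (1, 0, 0, 0, 0) = 1 := by
  have := D.phi_int 1
  simpa using this

lemma Dat.norm_phi (a : V) : Algebra.norm ℤ (D.phi a) = (matv a).det := by
  have h := Algebra.coe_norm_int (D.phi a)
  rw [D.coe_phi, D.normK] at h
  exact_mod_cast h

end
end C41

namespace C41
open NumberField
section
variable {K : Type} [Field K] [NumberField K] (D : Dat K)

lemma Dat.phi_expand (a0 a1 a2 a3 a4 : ℤ) :
    D.phi (a0, a1, a2, a3, a4) = a0 + a1 * D.phi (0,1,0,0,0) + a2 * D.phi (0,0,1,0,0)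
      + a3 * D.phi (0,0,0,1,0) + a4 * D.phi (0,0,0,0,1) := by
  apply RingOfIntegers.ext
  simp [Dat.phiK]

lemma Dat.not_unit {π : V} (h : (matv π).det.natAbs ≠ 1) : ¬ IsUnit (D.phi π) := by
  intro hu
  have := hu.map (Algebra.norm ℤ)
  rw [D.norm_phi, Int.isUnit_iff_natAbs_eq] at this
  exact h this

lemma Dat.sat {π α β1 β2 β3 β4 : V} {p r1 r2 r3 r4 : ℤ} (hp : Prime p)
    (hα : mulv π α = (p,0,0,0,0)) (h1 : mulv π β1 = (-r1,1,0,0,0)) (h2 : mulv π β2 = (-r2,0,1,0,0))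
    (h3 : mulv π β3 = (-r3,0,0,1,0)) (h4 : mulv π β4 = (-r4,0,0,0,1))
    (hN : (matv π).det.natAbs ≠ 1) {x : 𝓞 K} {a : V} (hx : D.phi π * x = D.phi a) :
    ∃ b, x = D.phi b := by
  obtain ⟨a0, a1, a2, a3, a4⟩ := a
  have gα : D.phi π * D.phi α = (p : 𝓞 K) := by rw [← D.phi_mul, hα, D.phi_int]
  have g1 : D.phi π * D.phi β1 = -r1 + D.phi (0,1,0,0,0) := by
    rw [← D.phi_mul, h1, D.phi_expand]; push_cast; ring
  have g2 : D.phi π * D.phi β2 = -r2 + D.phi (0,0,1,0,0) := by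
    rw [← D.phi_mul, h2, D.phi_expand]; push_cast; ring
  have g3 : D.phi π * D.phi β3 = -r3 + D.phi (0,0,0,1,0) := by
    rw [← D.phi_mul, h3, D.phi_expand]; push_cast; ring
  have g4 : D.phi π * D.phi β4 = -r4 + D.phi (0,0,0,0,1) := by
    rw [← D.phi_mul, h4, D.phi_expand]; push_cast; ring
  have hπ : D.phi π ≠ 0 := by
    intro h
    rw [h, zero_mul] at gα
    exact hp.ne_zero (by exact_mod_cast gα.symm)
  set bb : V := a1 • β1 + a2 • β2 + a3 • β3 + a4 • β4 with hbb
  set c : ℤ := a0 + a1 * r1 + a2 * r2 + a3 * r3 + a4 * r4 with hc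
  have key : D.phi π * (x - D.phi bb) = (c : 𝓞 K) := by
    rw [mul_sub, hx, hbb, hc]
    simp only [D.phi_add, D.phi_smul]
    rw [D.phi_expand]
    push_cast
    linear_combination (-(a1 : 𝓞 K)) * g1 - (a2 : 𝓞 K) * g2 - (a3 : 𝓞 K) * g3 - (a4 : 𝓞 K) * g4
  by_cases hd : p ∣ c
  · obtain ⟨k, hk⟩ := hd
    refine ⟨k • α + bb, ?_⟩
    apply mul_left_cancel₀ hπ
    rw [D.phi_add, D.phi_smul]
    rw [hk] at key
    push_cast at key
    linear_combination key - (k : 𝓞 K) * gα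
  · exfalso
    have hco : IsCoprime p c := (Prime.coprime_iff_not_dvd hp).2 hd
    obtain ⟨s, t, hst⟩ := hco
    refine D.not_unit hN (IsUnit.of_mul_eq_one (D.phi α * s + (x - D.phi bb) * t) ?_)
    have : (s : 𝓞 K) * p + t * c = 1 := by exact_mod_cast hst
    linear_combination (s : 𝓞 K) * gα + (t : 𝓞 K) * key + this

lemma Dat.sixty (x : 𝓞 K) : ∃ a, (60 : 𝓞 K) * x = D.phi a := by
  have ht : ∀ j, ∃ z : ℤ, Algebra.trace ℚ K ((x : K) * D.b j) = z := by
    intro j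
    refine ⟨Algebra.trace ℤ (𝓞 K) (x * D.phi (ev5 j)), ?_⟩
    rw [Algebra.coe_trace_int, D.b_eq]
    simp
  choose t ht using ht
  have hsum : (x : K) = ∑ i, D.b.repr (x : K) i • D.b i := (D.b.sum_repr _).symm
  set c := D.b.repr (x : K) with hc
  have hT : ∀ j, (t j : ℚ) = ∑ i, c i * Algebra.trace ℚ K (D.b i * D.b j) := by
    intro j
    rw [← ht j]
    conv_lhs => rw [hsum]
    rw [Finset.sum_mul, map_sum]
    refine Finset.sum_congr rfl fun i _ => ?_
    rw [smul_mul_assoc, map_smul, smul_eq_mul]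
  have hT2 : ∀ i j, Algebra.trace ℚ K (D.b i * D.b j) =
      ((5 * (mulv (ev5 i) (ev5 j)).1 + 30 * (mulv (ev5 i) (ev5 j)).2.2.2.1
        - 60 * (mulv (ev5 i) (ev5 j)).2.2.2.2 : ℤ) : ℚ) := by
    intro i j
    rw [D.b_eq, D.b_eq, ← D.phiK_mul, D.traceK]
  simp only [hT2] at hT
  have t0 := hT 0; have t1 := hT 1; have t2 := hT 2; have t3 := hT 3; have t4 := hT 4
  simp [Fin.sum_univ_succ, mulv, ev5] at t0 t1 t2 t3 t4
  norm_num at t0 t1 t2 t3 t4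
  refine ⟨(-636 * t 0 + 888 * t 1 - 18 * t 2 - 72 * t 3 - 90 * t 4,
    888 * t 0 - 1178 * t 1 + 21 * t 2 + 90 * t 3 + 119 * t 4,
    -18 * t 0 + 21 * t 1 - t 3 - 2 * t 4,
    -72 * t 0 + 90 * t 1 - t 2 - 6 * t 3 - 9 * t 4,
    -90 * t 0 + 119 * t 1 - 2 * t 2 - 9 * t 3 - 12 * t 4), ?_⟩
  apply RingOfIntegers.ext
  apply D.b.repr.injective
  ext i
  rw [D.coe_phi, D.repr_phiK]
  have h60 : (((60 : 𝓞 K) * x : 𝓞 K) : K) = (60 : ℚ) • (x : K) := by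
    rw [Algebra.smul_def, map_ofNat]
    exact (map_mul (algebraMap (𝓞 K) K) _ _).trans (by rw [map_ofNat])
  rw [h60, map_smul, Finsupp.smul_apply, smul_eq_mul]
  change 60 * c i = _
  fin_cases i <;> simp [co] <;> linarith

lemma Dat.surj (x : 𝓞 K) : ∃ a, x = D.phi a := by
  have s2 : ∀ {x : 𝓞 K} {a : V}, D.phi (-22,46,-18,-22,-9) * x = D.phi a → ∃ b, x = D.phi b :=
    fun h => D.sat (α := (-53,50,0,-2,-5)) (β1 := (-15,11,0,0,-1)) (β2 := (-6,0,1,0,0))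
      (β3 := (0,-2,0,1,0)) (β4 := (0,0,-2,0,1)) (p := 2) (r1 := 0) (r2 := 0) (r3 := 0) (r4 := 0)
      Int.prime_two (by decide) (by decide) (by decide) (by decide) (by decide)
      (by decide +kernel) h
  have st : ∀ {x : 𝓞 K} {a : V}, D.phi (1,-1,0,0,0) * x = D.phi a → ∃ b, x = D.phi b :=
    fun h => D.sat (α := (-16,29,-1,-3,-3)) (β1 := (-1,0,0,0,0)) (β2 := (-1,-1,0,0,0))
      (β3 := (5,-10,0,1,1)) (β4 := (5,-10,0,0,1)) (p := 2) (r1 := 1) (r2 := 1) (r3 := 1) (r4 := 1)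
      Int.prime_two (by decide) (by decide) (by decide) (by decide) (by decide)
      (by decide +kernel) h
  have sA : ∀ {x : 𝓞 K} {a : V}, D.phi (27,-57,13,100,-38) * x = D.phi a → ∃ b, x = D.phi b :=
    fun h => D.sat (α := (-1377,3034,-1183,-1455,-592)) (β1 := (-1184,2501,-962,-1183,-485))
      (β2 := (-2910,6091,-2349,-2886,-1183)) (β3 := (-2366,4945,-1913,-2349,-962))
      (β4 := (-5772,12064,-4675,-5739,-2349)) (p := 3) (r1 := 0) (r2 := 0) (r3 := 0) (r4 := 0)
      Int.prime_three (by decide) (by decide) (by decide) (by decide) (by decide)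
      (by decide +kernel) h
  have sB : ∀ {x : 𝓞 K} {a : V}, D.phi (5,-13,11,-8,0) * x = D.phi a → ∃ b, x = D.phi b :=
    fun h => D.sat (α := (93,-210,109,129,48)) (β1 := (96,-209,90,109,43))
      (β2 := (258,-549,221,270,109)) (β3 := (187,-389,144,178,74))
      (β4 := (540,-1132,441,541,221)) (p := 3) (r1 := 0) (r2 := 0) (r3 := 1) (r4 := 0)
      Int.prime_three (by decide) (by decide) (by decide) (by decide) (by decide)
      (by decide +kernel) h
  have sF : ∀ {x : 𝓞 K} {a : V}, D.phi (-7,13,-3,-4,-2) * x = D.phi a → ∃ b, x = D.phi b :=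
    fun h => D.sat (α := (19,-22,1,1,2)) (β1 := (-9,11,-1,0,-1))
      (β2 := (-14,17,-1,-2,-1)) (β3 := (-14,15,1,-1,-2))
      (β4 := (-10,16,-7,5,-1)) (p := 5) (r1 := 3) (r2 := 4) (r3 := 4) (r4 := 2)
      (by norm_num) (by decide) (by decide) (by decide) (by decide) (by decide)
      (by decide +kernel) h
  obtain ⟨a, ha⟩ := D.sixty x
  have k2 : D.phi (-22,46,-18,-22,-9) * D.phi (1,-1,0,0,0) ^ 4
      = 2 * D.phi (-47,97,-35,-53,-19) := by
    have e : (2 : 𝓞 K) = D.phi (2,0,0,0,0) := by rw [D.phi_int]; norm_num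
    rw [e]
    simp only [pow_succ, pow_zero, one_mul, ← D.phi_mul]
    exact congrArg D.phi (by decide)
  have k3 : D.phi (27,-57,13,100,-38) ^ 2 * D.phi (5,-13,11,-8,0) ^ 3
      = 3 * D.phi (433363371251,-1035824129769,549316540477,686599347332,-380371326212) := by
    have e : (3 : 𝓞 K) = D.phi (3,0,0,0,0) := by rw [D.phi_int]; norm_num
    rw [e]
    simp only [pow_succ, pow_zero, one_mul, ← D.phi_mul]
    exact congrArg D.phi (by decide)
  have k5 : D.phi (-7,13,-3,-4,-2) ^ 5
      = 5 * D.phi (-1227335,2566199,-995651,-1222052,-499978) := by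
    have e : (5 : 𝓞 K) = D.phi (5,0,0,0,0) := by rw [D.phi_int]; norm_num
    rw [e]
    simp only [pow_succ, pow_zero, one_mul, ← D.phi_mul]
    exact congrArg D.phi (by decide)
  -- strip a power of a prime element
  have strip : ∀ (π : V), (∀ {x : 𝓞 K} {a : V}, D.phi π * x = D.phi a → ∃ b, x = D.phi b) →
      ∀ (n : ℕ) (x : 𝓞 K), (∃ a, D.phi π ^ n * x = D.phi a) → ∃ a, x = D.phi a := by
    intro π hπ n
    induction n with
    | zero => rintro x ⟨a, ha⟩; exact ⟨a, by simpa using ha⟩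
    | succ n ih =>
      rintro x ⟨a, ha⟩
      apply ih
      obtain ⟨b, hb⟩ := hπ (x := D.phi π ^ n * x) (a := a) (by rw [← ha]; ring)
      exact ⟨b, hb⟩
  apply strip _ s2 2
  apply strip _ st 8
  apply strip _ sA 2
  apply strip _ sB 3
  apply strip _ sF 5
  refine ⟨mulv (mulv (-47,97,-35,-53,-19) (-47,97,-35,-53,-19))
    (mulv (433363371251,-1035824129769,549316540477,686599347332,-380371326212)
      (mulv (-1227335,2566199,-995651,-1222052,-499978) a)), ?_⟩
  simp only [D.phi_mul]
  rw [← ha]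
  generalize D.phi (-22,46,-18,-22,-9) = p2 at *
  generalize D.phi (1,-1,0,0,0) = t at *
  generalize D.phi (27,-57,13,100,-38) = A at *
  generalize D.phi (5,-13,11,-8,0) = B at *
  generalize D.phi (-7,13,-3,-4,-2) = F at *
  generalize D.phi (-47,97,-35,-53,-19) = v2 at *
  generalize D.phi (433363371251,-1035824129769,549316540477,686599347332,-380371326212) = v3 at *
  generalize D.phi (-1227335,2566199,-995651,-1222052,-499978) = v5 at *
  calc F ^ 5 * (B ^ 3 * (A ^ 2 * (t ^ 8 * (p2 ^ 2 * x))))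
      = (p2 * t ^ 4) ^ 2 * (A ^ 2 * B ^ 3) * F ^ 5 * x := by ring
    _ = v2 * v2 * (v3 * (v5 * (60 * x))) := by rw [k2, k3, k5]; ring

end
end C41

namespace C41
open NumberField
section
variable {K : Type} [Field K] [NumberField K] (D : Dat K)

lemma Dat.sum_phi (g : Fin 5 → ℤ) :
    ∑ i, g i • D.phi (ev5 i) = D.phi (g 0, g 1, g 2, g 3, g 4) := by
  rw [D.phi_expand]
  simp [Fin.sum_univ_succ, ev5, D.phi_one]
  simp [add_assoc]

/-- The integral basis. -/
noncomputable def Dat.ib : Module.Basis (Fin 5) ℤ (𝓞 K) :=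
  Module.Basis.mk (v := fun i => D.phi (ev5 i))
    (by
      rw [Fintype.linearIndependent_iff]
      intro g hg
      rw [D.sum_phi, ← D.phi_zero] at hg
      have := D.phi_inj hg
      simp only [Prod.ext_iff, Prod.fst_zero, Prod.snd_zero] at this
      obtain ⟨h0, h1, h2, h3, h4⟩ := this
      intro i; fin_cases i <;> assumption)
    (by
      rintro x -
      obtain ⟨⟨a0, a1, a2, a3, a4⟩, rfl⟩ := D.surj x
      have := D.sum_phi ![a0, a1, a2, a3, a4]
      simp only [Matrix.cons_val] at this
      rw [← this]
      exact Submodule.sum_mem _ fun i _ => Submodule.smul_mem _ _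
        (Submodule.subset_span ⟨i, rfl⟩))

/-- The trace form. -/
def trm : Matrix (Fin 5) (Fin 5) ℤ := Matrix.of fun i j =>
  5 * (mulv (ev5 i) (ev5 j)).1 + 30 * (mulv (ev5 i) (ev5 j)).2.2.2.1
        - 60 * (mulv (ev5 i) (ev5 j)).2.2.2.2

lemma trm_det : trm.det = 16200000 := by decide +kernel

lemma Dat.discr_eq (D : Dat K) : NumberField.discr K = 16200000 := by
  rw [← NumberField.discr_eq_discr K D.ib, Algebra.discr_def, ← trm_det]
  congr 1
  ext i j
  rw [Algebra.traceMatrix_apply, Algebra.traceForm_apply, Dat.ib, Module.Basis.mk_apply,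
    Module.Basis.mk_apply, ← D.phi_mul]
  have h := Algebra.coe_trace_int (D.phi (mulv (ev5 i) (ev5 j)))
  rw [D.coe_phi, D.traceK] at h
  simp only [trm, Matrix.of_apply]
  exact_mod_cast h

lemma Dat.finrank (D : Dat K) : Module.finrank ℚ K = 5 := by
  rw [Module.finrank_eq_card_basis D.b]; simp

lemma root_gt {x : ℝ} (h : x ^ 5 = 30 * x ^ 2 - 45 * x + 18) : 2 < x := by
  by_contra hx
  push Not at hx
  rcases le_total x 1 with h1 | h1
  · have h5 : x ^ 5 ≤ 1 := by
      rcases le_total 0 x with h0 | h0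
      · exact pow_le_one₀ h0 h1
      · exact (Odd.pow_nonpos (by decide) h0).trans zero_le_one
    nlinarith [sq_nonneg (x - 3 / 4)]
  · obtain ⟨t, rfl⟩ : ∃ t, x = 1 + t := ⟨x - 1, by ring⟩
    have h0 : 0 ≤ t := by linarith
    have ht : t ≤ 1 := by linarith
    have a1 : t ^ 3 ≤ t ^ 2 := pow_le_pow_of_le_one h0 ht (by norm_num)
    have a2 : t ^ 4 ≤ t ^ 2 := pow_le_pow_of_le_one h0 ht (by norm_num)
    have a3 : t ^ 5 ≤ t ^ 2 := pow_le_pow_of_le_one h0 ht (by norm_num)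
    nlinarith [sq_nonneg t]

lemma root_unique {x y : ℝ} (h : x ^ 5 = 30 * x ^ 2 - 45 * x + 18)
    (h' : y ^ 5 = 30 * y ^ 2 - 45 * y + 18) : x = y := by
  have hx := root_gt h
  have hy := root_gt h'
  obtain ⟨a, rfl⟩ : ∃ a, x = 2 + a := ⟨x - 2, by ring⟩
  obtain ⟨b, rfl⟩ : ∃ b, y = 2 + b := ⟨y - 2, by ring⟩
  have ha : 0 < a := by linarith
  have hb : 0 < b := by linarith
  have key : (a - b) * (5 + 50 * (a + b) + 40 * (a ^ 2 + a * b + b ^ 2)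
      + 10 * (a ^ 3 + a ^ 2 * b + a * b ^ 2 + b ^ 3)
      + (a ^ 4 + a ^ 3 * b + a ^ 2 * b ^ 2 + a * b ^ 3 + b ^ 4)) = 0 := by
    linear_combination h - h'
  have : 0 < (5 + 50 * (a + b) + 40 * (a ^ 2 + a * b + b ^ 2)
      + 10 * (a ^ 3 + a ^ 2 * b + a * b ^ 2 + b ^ 3)
      + (a ^ 4 + a ^ 3 * b + a ^ 2 * b ^ 2 + a * b ^ 3 + b ^ 4)) := by positivity
  rcases mul_eq_zero.1 key with h | h
  · rw [sub_eq_zero.1 h]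
  · exact absurd h this.ne'

lemma Dat.hom_ext (D : Dat K) {φ ψ : K →+* ℂ} (h : φ D.θ = ψ D.θ) : φ = ψ := by
  have : φ.toRatAlgHom.toLinearMap = ψ.toRatAlgHom.toLinearMap := by
    apply D.b.ext
    intro i
    rw [D.hb]
    fin_cases i <;> simp [h, map_ofNat]
  ext x
  exact congrArg (fun l => l x) this

lemma Dat.real_unique (D : Dat K) {φ ψ : K →+* ℂ} (hφ : ComplexEmbedding.IsReal φ)
    (hψ : ComplexEmbedding.IsReal ψ) : φ = ψ := by
  apply D.hom_ext
  have aux : ∀ {φ : K →+* ℂ}, ComplexEmbedding.IsReal φ → ∃ r : ℝ, φ D.θ = r ∧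
      r ^ 5 = 30 * r ^ 2 - 45 * r + 18 := by
    intro φ h
    have h1 : (starRingEnd ℂ) (φ D.θ) = φ D.θ := by
      have := congrArg (fun l => l D.θ) h.star_eq
      exact this
    obtain ⟨r, hr⟩ := Complex.conj_eq_iff_real.1 h1
    refine ⟨r, hr, ?_⟩
    have h2 := congrArg φ D.h5
    simp only [map_pow, map_add, map_sub, map_mul, map_ofNat, hr] at h2
    exact_mod_cast h2
  obtain ⟨r, hr, h⟩ := aux hφ
  obtain ⟨s, hs, h'⟩ := aux hψ
  rw [hr, hs, root_unique h h']

lemma Dat.places (D : Dat K) : InfinitePlace.nrRealPlaces K = 1 ∧ InfinitePlace.nrComplexPlaces K = 2 := by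
  have h1 : InfinitePlace.nrRealPlaces K ≤ 1 := by
    classical
    refine (@Fintype.card_le_one_iff _ _).2 ?_
    rintro ⟨a, ha⟩ ⟨b, hb⟩
    rw [InfinitePlace.isReal_iff] at ha hb
    apply Subtype.ext
    change a = b
    rw [← InfinitePlace.mk_embedding a, ← InfinitePlace.mk_embedding b, D.real_unique ha hb]
  have h2 := InfinitePlace.card_add_two_mul_card_eq_rank K
  rw [D.finrank] at h2
  omega

open scoped Nat Real in
lemma Dat.mink (D : Dat K) : ⌊((4 / π) ^ InfinitePlace.nrComplexPlaces K *
  ((Module.finrank ℚ K)! / (Module.finrank ℚ K) ^ (Module.finrank ℚ K) * √|(discr K : ℝ)|))⌋₊ ≤ 250 := by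
  rw [D.places.2, D.finrank, D.discr_eq]
  apply Nat.le_of_lt_succ
  rw [Nat.floor_lt (by positivity)]
  have hs : √|(((16200000 : ℤ)) : ℝ)| ≤ 4024.93 := by
    rw [Real.sqrt_le_left (by norm_num)]
    norm_num
  have hp : 4 / π ≤ 4 / 3.1415 := by
    have := Real.pi_gt_d4
    gcongr
  have hp0 : 0 ≤ 4 / π := by positivity
  have h5 : ((5 ! : ℕ) : ℝ) = 120 := by norm_num [Nat.factorial]
  calc (4 / π) ^ 2 * ((5 ! : ℕ) / ((5 : ℕ) : ℝ) ^ 5 * √|(((16200000 : ℤ)) : ℝ)|)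
      ≤ (4 / 3.1415) ^ 2 * ((5 ! : ℕ) / ((5 : ℕ) : ℝ) ^ 5 * 4024.93) := by gcongr
    _ < _ := by rw [h5]; norm_num

end
end C41

namespace C41
open NumberField
/-- Elements of prime norm `± p`. -/
def gtab : List (ℕ × V) := [
  (13, (11, -22, 1, 54, -19)), (19, (-1, 0, 1, -1, 0)), (23, (-107, 148, -3, -12, -15)),
  (29, (19, -1, -1, -2, 0)), (29, (7, -14, 7, -3, 0)), (37, (17, -36, 14, 17, 7)),
  (37, (-7, 10, 0, -1, -1)), (37, (-17, 23, -11, 3, 1)), (43, (-5, 8, 2, -3, -1)),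
  (47, (-167, 250, -8, -24, -26)), (47, (-13, 7, -1, -1, -1)), (47, (17, -29, 1, 3, 3)),
  (53, (1, -2, 1, 1, 0)), (67, (7, -16, 8, 9, -5)), (71, (1, -4, 3, 3, -2)),
  (71, (239, -343, 7, 29, 35)), (73, (43, 9, -4, -6, -1)), (89, (37, -49, 1, 6, 4)),
  (89, (1, -3, 1, 0, 0)), (101, (61, -128, 50, 61, 25)), (107, (1, -1, 0, 1, 0)),
  (109, (-5, 7, 0, 0, -1)), (113, (13, -48, 63, -95, 16)), (113, (31, -52, 15, -6, 3)),
  (113, (37, -68, 2, 7, 7)), (127, (-5, 11, -4, -5, -2)), (127, (-29, 61, -24, -29, -12)),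
  (127, (5, -15, 13, -7, -1)), (131, (-1, 3, -3, 2, 0)), (131, (-1, 15, -14, -16, -5)),
  (139, (17, -57, 4, 8, 5)), (149, (-5, 2, 0, 0, 0)), (149, (109, -192, 5, 19, 20)),
  (151, (-1, 9, -18, 30, -5)), (151, (23, -23, -1, 0, 2)), (157, (23, -45, 18, 8, -5)),
  (163, (1, 3, -9, 24, -6)), (173, (-59, 81, 0, -9, -8)), (179, (1, -3, 2, 1, 0)),
  (179, (5, -2, -1, -1, 0)), (181, (1, -2, 1, 0, 1)), (181, (-23, -1, 1, 4, 0)),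
  (191, (-5, -4, 7, -8, 1)), (191, (29, -1, -2, -3, 0)), (193, (-221, 240, -2, -14, -24)),
  (197, (-5, 10, -3, -6, -3)), (211, (-409, 550, -12, -43, -55)), (211, (-5, 56, 8, 3, -3)),
  (223, (37, -50, 1, 4, 5)), (227, (-1, 1, 0, 2, -1)), (233, (1, 6, 1, -2, -1)),
  (239, (5, -14, 12, -7, -1)), (239, (-17, 28, -1, -2, -3))]

/-- `P₀(r)`. -/
def p0 (r : ℤ) : ℤ := r ^ 5 - 30 * r ^ 2 + 45 * r - 18

/-- `3 γ` as a polynomial in `r`. -/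
def ev3 (γ : V) (r : ℤ) : ℤ :=
  3 * γ.1 + 3 * γ.2.1 * r + 3 * γ.2.2.1 * r ^ 2 + γ.2.2.2.1 * r ^ 3 + γ.2.2.2.2 * r ^ 4

lemma gtab_det : ∀ e ∈ gtab, (matv e.2).det.natAbs = e.1 := by decide +kernel

lemma gtab_roots : (List.range 251).all (fun p => decide (p ≤ 5) ||
    ([2, 3, 5, 7, 11, 13].any fun d => decide (p % d = 0) && decide (p ≠ d)) ||
    (List.range p).all fun r => decide (p0 r % p ≠ 0) ||
      gtab.any fun e => decide (e.1 = p) && decide (ev3 e.2 r % p = 0)) = true := by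
  decide +kernel

/-- Powers. -/
def powv (a : V) : ℕ → V
  | 0 => (1, 0, 0, 0, 0)
  | n + 1 => mulv (powv a n) a

/-- Divisibility of all coordinates. -/
def dv (p : ℤ) (a : V) : Prop :=
  a.1 % p = 0 ∧ a.2.1 % p = 0 ∧ a.2.2.1 % p = 0 ∧ a.2.2.2.1 % p = 0 ∧ a.2.2.2.2 % p = 0

instance (p : ℤ) (a : V) : Decidable (dv p a) := by unfold dv; infer_instance

section
variable {K : Type} [Field K] [NumberField K] (D : Dat K)

lemma Dat.phi_pow (a : V) (n : ℕ) : D.phi (powv a n) = D.phi a ^ n := by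
  induction n with
  | zero => simp [powv, D.phi_one]
  | succ n ih => rw [powv, D.phi_mul, ih, pow_succ]

lemma Dat.dvd_of_dv {p : ℤ} {a : V} (h : dv p a) : (p : 𝓞 K) ∣ D.phi a := by
  obtain ⟨a0, a1, a2, a3, a4⟩ := a
  obtain ⟨h0, h1, h2, h3, h4⟩ := h
  obtain ⟨b0, rfl⟩ := Int.dvd_of_emod_eq_zero h0
  obtain ⟨b1, rfl⟩ := Int.dvd_of_emod_eq_zero h1
  obtain ⟨b2, rfl⟩ := Int.dvd_of_emod_eq_zero h2
  obtain ⟨b3, rfl⟩ := Int.dvd_of_emod_eq_zero h3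
  obtain ⟨b4, rfl⟩ := Int.dvd_of_emod_eq_zero h4
  exact ⟨D.phi (b0, b1, b2, b3, b4), (D.phi_smul p (b0, b1, b2, b3, b4))⟩

open Ideal in
lemma Dat.prin {P : Ideal (𝓞 K)} {γ : V} (hγ : D.phi γ ∈ P) (h0 : (matv γ).det.natAbs ≠ 0)
    (hN : (matv γ).det.natAbs ≤ absNorm P) : Submodule.IsPrincipal P := by
  have hle : span {D.phi γ} ≤ P := (span_singleton_le_iff_mem P).2 hγ
  obtain ⟨J, hJ⟩ := Ideal.dvd_iff_le.2 hle
  have h1 : absNorm (span {D.phi γ}) = (matv γ).det.natAbs := by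
    rw [absNorm_span_singleton, D.norm_phi]
  rw [hJ, map_mul] at h1
  have hJ1 : absNorm J = 1 := by
    have hJ0 : absNorm J ≠ 0 := by rintro h; rw [h, mul_zero] at h1; exact h0 h1.symm
    have hP0 : 0 < absNorm P := by
      rcases Nat.eq_zero_or_pos (absNorm P) with h | h
      · rw [h, zero_mul] at h1; exact absurd h1.symm h0
      · exact h
    rw [← h1] at hN
    have := Nat.le_of_mul_le_mul_left (hN.trans_eq (mul_one _).symm) hP0
    omega
  rw [absNorm_eq_one_iff] at hJ1
  rw [hJ1, mul_top] at hJ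
  exact ⟨⟨D.phi γ, hJ.symm⟩⟩

lemma Dat.ev_hom {p : ℕ} (ψ : 𝓞 K →+* ZMod p) (γ : V) :
    3 * ψ (D.phi γ) = 3 * γ.1 + 3 * γ.2.1 * ψ (D.phi (0,1,0,0,0))
      + 3 * γ.2.2.1 * ψ (D.phi (0,1,0,0,0)) ^ 2 + γ.2.2.2.1 * ψ (D.phi (0,1,0,0,0)) ^ 3
      + γ.2.2.2.2 * ψ (D.phi (0,1,0,0,0)) ^ 4 := by
  obtain ⟨a0, a1, a2, a3, a4⟩ := γ
  have h2 : D.phi (0,0,1,0,0) = D.phi (0,1,0,0,0) ^ 2 := by rw [← D.phi_pow]; rfl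
  have h3 : 3 * D.phi (0,0,0,1,0) = D.phi (0,1,0,0,0) ^ 3 := by
    have := D.phi_smul 3 (0,0,0,1,0)
    push_cast at this
    rw [← D.phi_pow, ← this]
    rfl
  have h4 : 3 * D.phi (0,0,0,0,1) = D.phi (0,1,0,0,0) ^ 4 := by
    have := D.phi_smul 3 (0,0,0,0,1)
    push_cast at this
    rw [← D.phi_pow, ← this]
    rfl
  have e : 3 * D.phi (a0, a1, a2, a3, a4) = 3 * a0 + 3 * a1 * D.phi (0,1,0,0,0) +
    3 * a2 * D.phi (0,1,0,0,0) ^ 2 + a3 * D.phi (0,1,0,0,0) ^ 3 + a4 * D.phi (0,1,0,0,0) ^ 4 := by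
    rw [D.phi_expand, ← h4, ← h3, ← h2]; ring
  have := congrArg ψ e
  simpa [map_ofNat] using this

open Ideal in
lemma Dat.prin_one (D : Dat K) {P : Ideal (𝓞 K)} [hP : P.IsPrime] {p : ℕ} (hp : p.Prime) (h7 : 7 ≤ p)
    (h250 : p ≤ 250) (hN : absNorm P = p) : Submodule.IsPrincipal P := by
  have hP0 : P ≠ ⊥ := by rintro rfl; simp at hN; omega
  have : P.IsMaximal := hP.isMaximal hP0
  have : Fact p.Prime := ⟨hp⟩
  have hcard : Nat.card (𝓞 K ⧸ P) = p := by
    rw [← hN, absNorm_apply, Submodule.cardQuot_apply]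
  have : Finite (𝓞 K ⧸ P) := Nat.finite_of_card_ne_zero (by omega)
  have := Fintype.ofFinite (𝓞 K ⧸ P)
  rw [Nat.card_eq_fintype_card] at hcard
  let ψ : 𝓞 K →+* ZMod p :=
    ((ZMod.ringEquivOfPrime (𝓞 K ⧸ P) hp hcard).symm : (𝓞 K ⧸ P) →+* ZMod p).comp (Ideal.Quotient.mk P)
  have hψ : ∀ x, ψ x = 0 → x ∈ P := by
    intro x hx
    have : (ZMod.ringEquivOfPrime (𝓞 K ⧸ P) hp hcard).symm (Ideal.Quotient.mk P x) = 0 := hx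
    rwa [EmbeddingLike.map_eq_zero_iff, Ideal.Quotient.eq_zero_iff_mem] at this
  set r := ψ (D.phi (0,1,0,0,0)) with hr
  have hroot : r ^ 5 = 30 * r ^ 2 - 45 * r + 18 := by
    have : D.phi (0,1,0,0,0) ^ 5 = 30 * D.phi (0,1,0,0,0) ^ 2 - 45 * D.phi (0,1,0,0,0) + 18 := by
      apply RingOfIntegers.ext
      have e : D.phiK (0,1,0,0,0) = D.θ := by simp [Dat.phiK]
      simpa [e, map_ofNat] using D.h5
    have h := congrArg ψ this
    simpa [map_ofNat] using h
  have hrv : ((r.val : ℤ) : ZMod p) = r := by simp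
  have key := gtab_roots
  rw [List.all_eq_true] at key
  have key2 := key p (List.mem_range.2 (by omega))
  simp only [Bool.or_eq_true, decide_eq_true_eq] at key2
  rcases key2 with (h | h) | h
  · omega
  · exfalso
    simp only [List.any_eq_true, Bool.and_eq_true, decide_eq_true_eq] at h
    obtain ⟨d, hd, hpd, hne⟩ := h
    rcases (Nat.dvd_prime hp).1 (Nat.dvd_of_mod_eq_zero hpd) with h | h
    · subst h; simp at hd
    · exact hne h.symm
  · rw [List.all_eq_true] at h
    have h2 := h r.val (List.mem_range.2 r.val_lt)
    simp only [Bool.or_eq_true, decide_eq_true_eq, List.any_eq_true, Bool.and_eq_true] at h2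
    rcases h2 with h2 | ⟨⟨q, γ⟩, he, rfl, hev⟩
    · exfalso
      apply h2
      apply Int.emod_eq_zero_of_dvd
      rw [← ZMod.intCast_zmod_eq_zero_iff_dvd]
      simp only [p0]
      push_cast at hrv ⊢
      rw [hrv]
      linear_combination hroot
    · have hd := gtab_det _ he
      refine D.prin (γ := γ) (hψ _ ?_) ?_ ?_
      · have h3 := D.ev_hom ψ γ
        rw [← hr] at h3
        have hz := (ZMod.intCast_zmod_eq_zero_iff_dvd _ _).2 (Int.dvd_of_emod_eq_zero hev)
        simp only [ev3] at hz
        push_cast at hrv hz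
        rw [hrv] at hz
        rw [hz] at h3
        have h30 : (3 : ZMod q) ≠ 0 := by
          intro h
          have : ((3 : ℕ) : ZMod q) = 0 := by exact_mod_cast h
          rw [ZMod.natCast_eq_zero_iff] at this
          have := Nat.le_of_dvd (by norm_num) this
          omega
        exact (mul_eq_zero.1 h3).resolve_left h30
      · simp only at hd; omega
      · rw [hd, hN]

open Ideal in
lemma Dat.prin_two (D : Dat K) {P : Ideal (𝓞 K)} [hP : P.IsPrime] {p : ℕ} (hp0 : p ≠ 0) (hmem : (p : 𝓞 K) ∈ P)
    (hN : absNorm P = p ^ 2) (y γ : V)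
    (h : dv p (mulv y (powv (0,1,0,0,0) (p ^ 2) - (0,1,0,0,0)) - γ))
    (h0 : (matv γ).det.natAbs ≠ 0) (h1 : (matv γ).det.natAbs ≤ p ^ 2) :
    Submodule.IsPrincipal P := by
  have hP0 : P ≠ ⊥ := by rintro rfl; simp at hN; omega
  have : P.IsMaximal := hP.isMaximal hP0
  have hcard : Nat.card (𝓞 K ⧸ P) = p ^ 2 := by
    rw [← hN, absNorm_apply, Submodule.cardQuot_apply]
  have : Finite (𝓞 K ⧸ P) := Nat.finite_of_card_ne_zero (by rw [hcard]; positivity)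
  have := Fintype.ofFinite (𝓞 K ⧸ P)
  let _ := Ideal.Quotient.field P
  rw [Nat.card_eq_fintype_card] at hcard
  have hE : D.phi (0,1,0,0,0) ^ (p ^ 2) - D.phi (0,1,0,0,0) ∈ P := by
    rw [← Ideal.Quotient.eq_zero_iff_mem, map_sub, map_pow, sub_eq_zero, ← hcard]
    exact FiniteField.pow_card _
  have h2 := D.dvd_of_dv h
  rw [D.phi_sub, D.phi_mul, D.phi_sub, D.phi_pow] at h2
  refine D.prin (γ := γ) ?_ h0 (hN ▸ h1)
  have h3 : D.phi y * (D.phi (0,1,0,0,0) ^ (p ^ 2) - D.phi (0,1,0,0,0)) - D.phi γ ∈ P :=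
    P.mem_of_dvd (by exact_mod_cast h2) hmem
  have h4 := P.mul_mem_left (D.phi y) hE
  have := P.sub_mem h4 h3
  rwa [sub_sub_cancel] at this

open Ideal in
theorem Dat.pid (D : Dat K) : IsPrincipalIdealRing (𝓞 K) := by
  apply RingOfIntegers.isPrincipalIdealRing_of_isPrincipal_of_pow_le_of_mem_primesOver_of_mem_Icc
  rintro p hp hpp P ⟨hP, hlies⟩ hle
  have hM := D.mink
  have hp250 := (Finset.mem_Icc.1 hp).2.trans hM
  replace hle := hle.trans hM
  have hnorm := Ideal.pow_inertiaDeg p P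
  have hmem : (p : 𝓞 K) ∈ P := by
    have : (p : ℤ) ∈ P.under ℤ := by
      rw [← hlies.over]; exact mem_span_singleton_self _
    simpa [Ideal.mem_comap] using this
  have hf : P.inertiaDeg ℤ ≠ 0 := by
    intro h
    rw [h, pow_zero] at hnorm
    exact hP.ne_top (absNorm_eq_one_iff.1 hnorm.symm)
  set f := P.inertiaDeg ℤ with hfdef
  have hpf : p ≤ absNorm P := by rw [← hnorm]; exact Nat.le_self_pow hf p
  have prod : ∀ a b, D.phi (mulv a b) ∈ P → D.phi a ∈ P ∨ D.phi b ∈ P := by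
    intro a b h
    rw [D.phi_mul] at h
    exact hP.mem_or_mem h
  have hphi : D.phi (p, 0, 0, 0, 0) ∈ P := by rw [D.phi_int]; exact_mod_cast hmem
  have hunit : ∀ a b, mulv a b = (1,0,0,0,0) → D.phi a ∉ P := by
    intro a b h ha
    apply hP.ne_top
    refine Ideal.eq_top_of_isUnit_mem P ha (IsUnit.of_mul_eq_one (D.phi b) ?_)
    rw [← D.phi_mul, h, D.phi_one]
  by_cases h7 : 7 ≤ p
  · have hf2 : f ≤ 2 := by
      by_contra hf3
      have : 7 ^ 3 ≤ p ^ f := (Nat.pow_le_pow_left h7 3).trans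
        (Nat.pow_le_pow_right (by omega) (by omega))
      omega
    have hf12 : f = 1 ∨ f = 2 := by omega
    rcases hf12 with h1 | h2
    · rw [h1, pow_one] at hnorm
      exact D.prin_one hpp h7 hp250 hnorm.symm
    · rw [h2] at hnorm hle
      have hp15 : p ≤ 15 := by nlinarith
      have : p = 7 ∨ p = 11 ∨ p = 13 := by
        clear_value f
        clear hnorm hle hpf prod hphi hunit hmem hlies hp hp250
        interval_cases p <;> first | omega | (exfalso; revert hpp; decide)
      rcases this with rfl | rfl | rfl
      · exact D.prin_two (by norm_num) hmem hnorm.symm (3,1,1,0,0) (-65,200,-210,244,-30)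
          (by decide +kernel) (by decide +kernel) (by decide +kernel)
      · exact D.prin_two (by norm_num) hmem hnorm.symm (5,9,5,5,1) (1,0,0,0,0)
          (by decide +kernel) (by decide +kernel) (by decide +kernel)
      · exact D.prin_two (by norm_num) hmem hnorm.symm (1,3,6,0,0) (11,-22,1,54,-19)
          (by decide +kernel) (by decide +kernel) (by decide +kernel)
  · have : p = 2 ∨ p = 3 ∨ p = 5 := by
      clear_value f
      clear hnorm hle hpf prod hphi hunit hmem hlies hp hp250
      interval_cases p <;> first | omega | (exfalso; revert hpp; decide)
    rcases this with rfl | rfl | rfl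
    · have e : ((2 : ℕ) : ℤ) = 2 := rfl
      rw [e, show ((2 : ℤ), (0 : ℤ), (0 : ℤ), (0 : ℤ), (0 : ℤ)) = mulv (-22,46,-18,-22,-9) (mulv (1,-1,0,0,0)
        (mulv (1,-1,0,0,0) (mulv (1,-1,0,0,0) (mulv (1,-1,0,0,0)
          (10309,-11649,125,721,1169))))) by decide] at hphi
      have ht : D.phi (1,-1,0,0,0) ∈ P → Submodule.IsPrincipal P := fun h =>
        D.prin h (by decide +kernel) (le_trans (by decide +kernel) hpf)
      rcases prod _ _ hphi with h | h
      · exact D.prin h (by decide +kernel) (le_trans (by decide +kernel) hpf)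
      rcases prod _ _ h with h | h
      · exact ht h
      rcases prod _ _ h with h | h
      · exact ht h
      rcases prod _ _ h with h | h
      · exact ht h
      rcases prod _ _ h with h | h
      · exact ht h
      · exact absurd h (hunit _ (-47,97,-35,-53,-19) (by decide))
    · have e : ((3 : ℕ) : ℤ) = 3 := rfl
      have hU : D.phi (794665794325133,-1661542857726814,644655935752109,791244280317947,323721785143348)
          ∉ P := hunit _
            (433363371251,-1035824129769,549316540477,686599347332,-380371326212) (by decide)
      rw [e, show ((3 : ℤ), (0 : ℤ), (0 : ℤ), (0 : ℤ), (0 : ℤ)) = mulv (27,-57,13,100,-38) (mulv (27,-57,13,100,-38)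
        (mulv (5,-13,11,-8,0) (mulv (5,-13,11,-8,0) (mulv (5,-13,11,-8,0)
          (794665794325133,-1661542857726814,644655935752109,791244280317947,323721785143348)))))
          by decide] at hphi
      have hA : D.phi (27,-57,13,100,-38) ∈ P → Submodule.IsPrincipal P := fun h =>
        D.prin h (by decide +kernel) (le_trans (by decide +kernel) hpf)
      have hB : D.phi (5,-13,11,-8,0) ∈ P → Submodule.IsPrincipal P := fun h =>
        D.prin h (by decide +kernel) (le_trans (by decide +kernel) hpf)
      rcases prod _ _ hphi with h | h
      · exact hA h
      rcases prod _ _ h with h | h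
      · exact hA h
      rcases prod _ _ h with h | h
      · exact hB h
      rcases prod _ _ h with h | h
      · exact hB h
      rcases prod _ _ h with h | h
      · exact hB h
      · exact absurd h hU
    · have e : ((5 : ℕ) : ℤ) = 5 := rfl
      rw [e, show ((5 : ℤ), (0 : ℤ), (0 : ℤ), (0 : ℤ), (0 : ℤ)) = mulv (powv (-7,13,-3,-4,-2) 5)
        (19,-70,69,-29,-10) by decide] at hphi
      rcases prod _ _ hphi with h | h
      · rw [D.phi_pow] at h
        exact D.prin (hP.mem_of_pow_mem _ h) (by decide +kernel) (le_trans (by decide +kernel) hpf)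
      · exact absurd h (hunit _ (-1227335,2566199,-995651,-1222052,-499978) (by decide))

end
end C41

namespace C41
open NumberField

/-- A linear functional on coordinate vectors. -/
def psi {R : Type} [CommRing R] (c : R × R × R × R) (a : V) : R :=
  a.1 + a.2.1 * c.1 + a.2.2.1 * c.2.1 + a.2.2.2.1 * c.2.2.1 + a.2.2.2.2 * c.2.2.2

/-- Multiplicativity conditions. -/
def okc {R : Type} [CommRing R] (c : R × R × R × R) : Prop :=
  c.1 * c.1 = c.2.1 ∧ c.1 * c.2.1 = 3 * c.2.2.1 ∧ c.1 * c.2.2.1 = c.2.2.2 ∧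
  c.1 * c.2.2.2 = 6 - 15 * c.1 + 10 * c.2.1 ∧ c.2.1 * c.2.1 = 3 * c.2.2.2 ∧
  c.2.1 * c.2.2.1 = 6 - 15 * c.1 + 10 * c.2.1 ∧
  c.2.1 * c.2.2.2 = 6 * c.1 - 15 * c.2.1 + 30 * c.2.2.1 ∧
  c.2.2.1 * c.2.2.1 = 2 * c.1 - 5 * c.2.1 + 10 * c.2.2.1 ∧
  c.2.2.1 * c.2.2.2 = 2 * c.2.1 - 15 * c.2.2.1 + 10 * c.2.2.2 ∧
  c.2.2.2 * c.2.2.2 = 60 - 150 * c.1 + 100 * c.2.1 + 6 * c.2.2.1 - 15 * c.2.2.2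

lemma psi_mul {R : Type} [CommRing R] {c : R × R × R × R} (h : okc c) (a b : V) :
    psi c (mulv a b) = psi c a * psi c b := by
  obtain ⟨h11, h12, h13, h14, h22, h23, h24, h33, h34, h44⟩ := h
  obtain ⟨a0, a1, a2, a3, a4⟩ := a
  obtain ⟨b0, b1, b2, b3, b4⟩ := b
  obtain ⟨c1, c2, c3, c4⟩ := c
  simp only [psi, mulv] at *
  push_cast
  linear_combination (-(a1 * b1 : R)) * h11 - (a1 * b2 + a2 * b1 : R) * h12
    - (a1 * b3 + a3 * b1 : R) * h13 - (a1 * b4 + a4 * b1 : R) * h14 - (a2 * b2 : R) * h22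
    - (a2 * b3 + a3 * b2 : R) * h23 - (a2 * b4 + a4 * b2 : R) * h24 - (a3 * b3 : R) * h33
    - (a3 * b4 + a4 * b3 : R) * h34 - (a4 * b4 : R) * h44

/-- Representatives of units modulo squares. -/
def epsv (t : Fin 2 × Fin 2 × Fin 2) : V :=
  mulv (powv (-1,0,0,0,0) t.1) (mulv (powv (-47,97,-35,-53,-19) t.2.1)
    (powv (-19,70,-69,29,10) t.2.2))

lemma eps_indep : ∀ t t' : Fin 2 × Fin 2 × Fin 2,
    psi ((10, 5, 4, 2) : ZMod 19 × _) (epsv t) ^ 9 = psi ((10, 5, 4, 2) : ZMod 19 × _) (epsv t') ^ 9 →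
    psi ((14, 22, 6, 26) : ZMod 29 × _) (epsv t) ^ 14
      = psi ((14, 22, 6, 26) : ZMod 29 × _) (epsv t') ^ 14 →
    psi ((20, 30, 15, 4) : ZMod 37 × _) (epsv t) ^ 18
      = psi ((20, 30, 15, 4) : ZMod 37 × _) (epsv t') ^ 18 → t = t' := by
  decide +kernel

lemma psi_sq {p k : ℕ} [Fact p.Prime] (hk : p - 1 = 2 * k) {c : ZMod p × ZMod p × ZMod p × ZMod p}
    (hc : okc c) {e e' b b' : V} (hb : mulv b b' = (1,0,0,0,0)) (h : e = mulv e' (mulv b b)) :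
    psi c e ^ k = psi c e' ^ k := by
  have h1 : psi c b ≠ 0 := by
    intro h0
    have := psi_mul hc b b'
    rw [hb, h0, zero_mul] at this
    simp [psi] at this
  rw [h, psi_mul hc, psi_mul hc, mul_pow, ← pow_two, ← pow_mul, ← hk,
    ZMod.pow_card_sub_one_eq_one h1, mul_one]

section
variable {K : Type} [Field K] [NumberField K] (D : Dat K)

/-- Units from coordinates. -/
def Dat.mkU (a b : V) (h : mulv a b = (1,0,0,0,0)) : (𝓞 K)ˣ :=
  ⟨D.phi a, D.phi b, by rw [← D.phi_mul, h, D.phi_one],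
    by rw [mul_comm, ← D.phi_mul, h, D.phi_one]⟩

/-- The representatives, as units. -/
def Dat.epsU (t : Fin 2 × Fin 2 × Fin 2) : (𝓞 K)ˣ :=
  D.mkU (-1,0,0,0,0) (-1,0,0,0,0) (by decide) ^ (t.1 : ℕ) *
  (D.mkU (-47,97,-35,-53,-19) (10309,-11649,125,721,1169) (by decide) ^ (t.2.1 : ℕ) *
   D.mkU (-19,70,-69,29,10) (1227335,-2566199,995651,1222052,499978) (by decide) ^ (t.2.2 : ℕ))

lemma Dat.epsU_coe (t : Fin 2 × Fin 2 × Fin 2) : ((D.epsU t : (𝓞 K)ˣ) : 𝓞 K) = D.phi (epsv t) := by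
  simp only [Dat.epsU, epsv, D.phi_mul, D.phi_pow, Units.val_mul, Units.val_pow_eq_pow_val]
  rfl

lemma Dat.eps_inj {t t' : Fin 2 × Fin 2 × Fin 2} {w : (𝓞 K)ˣ}
    (h : D.epsU t = D.epsU t' * w ^ 2) : t = t' := by
  obtain ⟨b, hb⟩ := D.surj (w : 𝓞 K)
  obtain ⟨b', hb'⟩ := D.surj ((w⁻¹ : (𝓞 K)ˣ) : 𝓞 K)
  have h1 : mulv b b' = (1,0,0,0,0) := by
    apply D.phi_inj
    rw [D.phi_mul, ← hb, ← hb', D.phi_one, Units.mul_inv]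
  have h2 : epsv t = mulv (epsv t') (mulv b b) := by
    apply D.phi_inj
    rw [D.phi_mul, D.phi_mul, ← hb, ← D.epsU_coe, ← D.epsU_coe, h, Units.val_mul,
      Units.val_pow_eq_pow_val, pow_two]
  have : Fact (Nat.Prime 19) := ⟨by norm_num⟩
  have : Fact (Nat.Prime 29) := ⟨by norm_num⟩
  have : Fact (Nat.Prime 37) := ⟨by norm_num⟩
  apply eps_indep
  · exact psi_sq (by norm_num) (by simp only [okc]; decide) h1 h2
  · exact psi_sq (by norm_num) (by simp only [okc]; decide) h1 h2
  · exact psi_sq (by norm_num) (by simp only [okc]; decide) h1 h2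

lemma Dat.rank (D : Dat K) : Units.rank K = 2 := by
  rw [Units.rank, InfinitePlace.card_eq_nrRealPlaces_add_nrComplexPlaces, D.places.1, D.places.2]

theorem Dat.unit_rep (u : (𝓞 K)ˣ) : ∃ t, ∃ w : (𝓞 K)ˣ, u = D.epsU t * w ^ 2 := by
  let H : Subgroup (𝓞 K)ˣ := (powMonoidHom 2 : (𝓞 K)ˣ →* (𝓞 K)ˣ).range
  let s : Fin 2 × (Fin (Units.rank K) → Fin 2) → (𝓞 K)ˣ ⧸ H := fun x =>
    ((-1) ^ (x.1 : ℕ) * ∏ i, Units.fundSystem K i ^ (x.2 i : ℕ) : (𝓞 K)ˣ)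
  have hs : Function.Surjective s := by
    intro q
    obtain ⟨v, rfl⟩ := QuotientGroup.mk_surjective q
    obtain ⟨⟨ζ, e⟩, hv, -⟩ := Units.exist_unique_eq_mul_prod K v
    simp only at hv
    have hz : ∃ a : Fin 2, (ζ : (𝓞 K)ˣ) = (-1) ^ (a : ℕ) := by
      rcases Units.torsion_eq_one_or_neg_one_of_odd_finrank (by rw [D.finrank]; decide) ζ with h | h
      · exact ⟨0, by simp [h]⟩
      · exact ⟨1, by simp [h]⟩
    obtain ⟨a, ha⟩ := hz
    refine ⟨(a, fun i => ⟨(e i % 2).toNat, by omega⟩), ?_⟩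
    refine QuotientGroup.eq.2 ?_
    refine ⟨∏ i, Units.fundSystem K i ^ (e i / 2), ?_⟩
    rw [hv, ha]
    simp only [powMonoidHom_apply]
    rw [mul_inv, mul_mul_mul_comm, inv_mul_cancel, one_mul, ← Finset.prod_pow,
      ← Finset.prod_inv_distrib, ← Finset.prod_mul_distrib]
    refine Finset.prod_congr rfl fun i _ => ?_
    rw [← zpow_natCast, ← zpow_natCast, ← zpow_mul, ← zpow_neg, ← zpow_add]
    congr 1
    push_cast
    omega
  let i : Fin 2 × Fin 2 × Fin 2 → (𝓞 K)ˣ ⧸ H := fun t => (D.epsU t : (𝓞 K)ˣ)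
  have hi : Function.Injective i := by
    intro t t' h
    obtain ⟨w, hw⟩ := QuotientGroup.eq.1 h
    simp only [powMonoidHom_apply] at hw
    exact (D.eps_inj (t := t') (t' := t) (w := w) (by rw [hw]; group)).symm
  have hinj : Function.Injective (Function.surjInv hs ∘ i) :=
    (Function.injective_surjInv hs).comp hi
  have hbij := (Fintype.bijective_iff_injective_and_card (Function.surjInv hs ∘ i)).2
    ⟨hinj, by simp [D.rank]⟩
  obtain ⟨t, ht⟩ := hbij.2 (Function.surjInv hs (u : (𝓞 K)ˣ ⧸ H))
  have ht2 := Function.injective_surjInv hs ht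
  obtain ⟨w, hw⟩ := QuotientGroup.eq.1 ht2
  simp only [powMonoidHom_apply] at hw
  exact ⟨t, w, by rw [hw]; group⟩

end
end C41

namespace C41
/-- The quintic. -/
noncomputable def qpol : Polynomial ℤ := Polynomial.X ^ 5 - 30 * Polynomial.X ^ 2 + 45 * Polynomial.X - 18

section
open Polynomial

lemma qpol_monic : qpol.Monic := by unfold qpol; monicity!

lemma qpol_deg : qpol.natDegree = 5 := by unfold qpol; compute_degree!

lemma qpol_shift : taylorEquiv (3 : ℤ) qpol
    = Polynomial.X ^ 5 + 15 * Polynomial.X ^ 4 + 90 * Polynomial.X ^ 3 + 240 * Polynomial.X ^ 2 + 270 * Polynomial.X + 90 := by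
  have : taylorEquiv (3 : ℤ) qpol = taylor 3 qpol := rfl
  rw [this, Polynomial.taylor_apply, qpol]
  simp
  ring

lemma shift_irred : Irreducible (Polynomial.X ^ 5 + 15 * Polynomial.X ^ 4 + 90 * Polynomial.X ^ 3 + 240 * Polynomial.X ^ 2 + 270 * Polynomial.X + 90 : Polynomial ℤ) := by
  set S : Polynomial ℤ := Polynomial.X ^ 5 + 15 * Polynomial.X ^ 4 + 90 * Polynomial.X ^ 3 + 240 * Polynomial.X ^ 2 + 270 * Polynomial.X + 90 with hS
  have hm : S.Monic := by rw [hS]; monicity!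
  have hd : S.natDegree = 5 := by rw [hS]; compute_degree!
  have hco : S = Polynomial.C 1 * Polynomial.X ^ 5 + Polynomial.C 15 * Polynomial.X ^ 4 + Polynomial.C 90 * Polynomial.X ^ 3 + Polynomial.C 240 * Polynomial.X ^ 2 + Polynomial.C 270 * Polynomial.X ^ 1
      + Polynomial.C 90 * Polynomial.X ^ 0 := by
    rw [hS]; simp
  refine Polynomial.IsEisensteinAt.irreducible (𝓟 := Ideal.span {(5 : ℤ)}) ?_ ?_ hm.isPrimitive (by omega)
  · refine ⟨?_, ?_, ?_⟩
    · rw [hm.leadingCoeff, Ideal.mem_span_singleton]; norm_num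
    · intro n hn
      rw [hd] at hn
      rw [Ideal.mem_span_singleton, hco]
      simp only [Polynomial.coeff_add, Polynomial.coeff_C_mul, Polynomial.coeff_X_pow]
      interval_cases n <;> norm_num
    · rw [Ideal.span_singleton_pow, Ideal.mem_span_singleton, hco]
      simp only [Polynomial.coeff_add, Polynomial.coeff_C_mul, Polynomial.coeff_X_pow]
      norm_num
  · rw [Ideal.span_singleton_prime (by norm_num)]
    norm_num

lemma qpol_irred : Irreducible (qpol.map (Int.castRingHom ℚ)) := by
  rw [← Polynomial.IsPrimitive.Int.irreducible_iff_irreducible_map_cast qpol_monic.isPrimitive,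
    ← MulEquiv.irreducible_iff (taylorEquiv (3 : ℤ)), qpol_shift]
  exact shift_irred

theorem exists_dat : ∃ (K : Type) (_ : Field K) (_ : NumberField K), Nonempty (Dat K) := by
  have : Fact (Irreducible (qpol.map (Int.castRingHom ℚ))) := ⟨qpol_irred⟩
  set p := qpol.map (Int.castRingHom ℚ) with hp
  have hd : p.natDegree = 5 := by rw [hp, qpol_monic.natDegree_map, qpol_deg]
  let pb := AdjoinRoot.powerBasis (f := p) qpol_irred.ne_zero
  have hfin : FiniteDimensional ℚ (AdjoinRoot p) := Module.Finite.of_basis pb.basis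
  have hc : CharZero (AdjoinRoot p) := algebraRat.charZero _
  have hnf : NumberField (AdjoinRoot p) := { to_charZero := hc, to_finiteDimensional := hfin }
  refine ⟨AdjoinRoot p, inferInstance, hnf, ⟨?_⟩⟩
  have hdim : pb.dim = 5 := hd
  have hw : ∀ i : Fin 5, IsUnit ((![1, 1, 1, 1 / 3, 1 / 3] : Fin 5 → ℚ) i) := by
    intro i; fin_cases i <;> simp
  refine ⟨AdjoinRoot.root p, ?_, (pb.basis.reindex (finCongr hdim)).isUnitSMul hw, ?_⟩
  · have hp' : (Polynomial.X ^ 5 - 30 * Polynomial.X ^ 2 + 45 * Polynomial.X - 18 : Polynomial ℚ) = p := by rw [hp, qpol]; simp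
    have h : Polynomial.eval₂ (AdjoinRoot.of p) (AdjoinRoot.root p)
        (Polynomial.X ^ 5 - 30 * Polynomial.X ^ 2 + 45 * Polynomial.X - 18 : Polynomial ℚ) = 0 := by
      rw [hp']; exact AdjoinRoot.eval₂_root p
    simp only [Polynomial.eval₂_sub, Polynomial.eval₂_add, Polynomial.eval₂_mul, Polynomial.eval₂_pow, Polynomial.eval₂_X, Polynomial.eval₂_ofNat] at h
    linear_combination h
  · intro i
    rw [Module.Basis.isUnitSMul_apply, Module.Basis.reindex_apply, pb.basis_eq_pow]
    have : pb.gen = AdjoinRoot.root p := rfl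
    rw [this]
    fin_cases i <;> simp [Algebra.smul_def] <;> ring
end
end C41

namespace C41

/-- Homogeneous evaluation of a coefficient list. -/
def evh {R : Type} [CommRing R] : List ℤ → R → R → R
  | [], _, _ => 0
  | c :: L, s, w => (c : R) * w ^ L.length + s * evh L s w

lemma evh_map {R S : Type} [CommRing R] [CommRing S] (φ : R →+* S) (L : List ℤ) (s w : R) :
    φ (evh L s w) = evh L (φ s) (φ w) := by
  induction L with
  | nil => simp [evh]
  | cons c L ih => simp [evh, ih]

lemma evh_cast {R : Type} [CommRing R] (L : List ℤ) (s w : ℤ) :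
    ((evh L s w : ℤ) : R) = evh L (s : R) (w : R) :=
  evh_map (Int.castRingHom R) L s w

/-- Homogeneous evaluation of a list of coordinate vectors. -/
def evhV : List V → ℤ → ℤ → V
  | [], _, _ => 0
  | c :: L, s, w => w ^ L.length • c + s • evhV L s w

lemma evhV_0 (L : List V) (s w : ℤ) : (evhV L s w).1 = evh (L.map (·.1)) s w := by
  induction L with
  | nil => simp [evh, evhV]
  | cons c L ih => simp [evh, evhV, ih]; ring
lemma evhV_1 (L : List V) (s w : ℤ) : (evhV L s w).2.1 = evh (L.map (·.2.1)) s w := by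
  induction L with
  | nil => simp [evh, evhV]
  | cons c L ih => simp [evh, evhV, ih]; ring
lemma evhV_2 (L : List V) (s w : ℤ) : (evhV L s w).2.2.1 = evh (L.map (·.2.2.1)) s w := by
  induction L with
  | nil => simp [evh, evhV]
  | cons c L ih => simp [evh, evhV, ih]; ring
lemma evhV_3 (L : List V) (s w : ℤ) : (evhV L s w).2.2.2.1 = evh (L.map (·.2.2.2.1)) s w := by
  induction L with
  | nil => simp [evh, evhV]
  | cons c L ih => simp [evh, evhV, ih]; ring
lemma evhV_4 (L : List V) (s w : ℤ) : (evhV L s w).2.2.2.2 = evh (L.map (·.2.2.2.2)) s w := by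
  induction L with
  | nil => simp [evh, evhV]
  | cons c L ih => simp [evh, evhV, ih]; ring

/-- Integers as coordinate vectors. -/
def emb (n : ℤ) : V := (n, 0, 0, 0, 0)

lemma evhV_emb (L : List ℤ) (s w : ℤ) : evhV (L.map emb) s w = emb (evh L s w) := by
  induction L with
  | nil => rfl
  | cons c L ih =>
    simp only [List.map_cons, evhV, ih, evh, List.length_map, emb]
    ext <;> simp; ring

/-- Sum of polynomials. -/
def padd : List V → List V → List V
  | [], M => M
  | L, [] => L
  | a :: L, b :: M => (a + b) :: padd L M

/-- Product of polynomials. -/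
def pmul : List V → List V → List V
  | [], _ => []
  | a :: L, M => padd (M.map (mulv a)) (0 :: pmul L M)

section
variable {K : Type} [Field K] [NumberField K] (D : Dat K)
open NumberField

/-- Evaluation of a polynomial with coefficients given by coordinates. -/
def Dat.ev1 : List V → K → K
  | [], _ => 0
  | c :: L, x => D.phiK c + x * Dat.ev1 L x

lemma Dat.phiK_add (a b : V) : D.phiK (a + b) = D.phiK a + D.phiK b := by
  obtain ⟨a0, a1, a2, a3, a4⟩ := a
  obtain ⟨b0, b1, b2, b3, b4⟩ := b
  simp [Dat.phiK]; ring

lemma Dat.phiK_smul (n : ℤ) (a : V) : D.phiK (n • a) = n * D.phiK a := by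
  obtain ⟨a0, a1, a2, a3, a4⟩ := a
  simp [Dat.phiK]; ring

lemma Dat.phiK_zero : D.phiK 0 = 0 := by
  simp [Dat.phiK]

lemma Dat.ev1_padd (L M : List V) (x : K) : D.ev1 (padd L M) x = D.ev1 L x + D.ev1 M x := by
  induction L generalizing M with
  | nil => simp [padd, Dat.ev1]
  | cons a L ih =>
    cases M with
    | nil => simp [padd, Dat.ev1]
    | cons b M => simp only [padd, Dat.ev1, ih, D.phiK_add]; ring

lemma Dat.ev1_mulv (a : V) (M : List V) (x : K) :
    D.ev1 (M.map (mulv a)) x = D.phiK a * D.ev1 M x := by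
  induction M with
  | nil => simp [Dat.ev1]
  | cons b M ih => simp only [List.map_cons, Dat.ev1, ih, D.phiK_mul]; ring

lemma Dat.ev1_pmul (L M : List V) (x : K) : D.ev1 (pmul L M) x = D.ev1 L x * D.ev1 M x := by
  induction L with
  | nil => simp [pmul, Dat.ev1]
  | cons a L ih => simp only [pmul, D.ev1_padd, D.ev1_mulv, Dat.ev1, ih, D.phiK_zero]; ring

lemma Dat.ev1_smul (n : ℤ) (M : List V) (x : K) :
    D.ev1 (M.map (n • ·)) x = n * D.ev1 M x := by
  induction M with
  | nil => simp [Dat.ev1]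
  | cons b M ih => simp only [List.map_cons, Dat.ev1, ih, D.phiK_smul]; ring

lemma Dat.ev1_evh (L : List V) (s w : ℤ) (hw : w ≠ 0) :
    (w : K) * D.phiK (evhV L s w) = w ^ L.length * D.ev1 L (s / w) := by
  have hw' : (w : K) ≠ 0 := by exact_mod_cast hw
  induction L with
  | nil => simp [evhV, Dat.ev1, D.phiK_zero]
  | cons c L ih =>
    simp only [evhV, Dat.ev1, D.phiK_add, D.phiK_smul, List.length_cons]
    push_cast
    have : (w : K) * (s * D.phiK (evhV L s w)) = s * (w ^ L.length * D.ev1 L (s / w)) := by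
      rw [← ih]; ring
    rw [mul_add, this]
    field_simp
    ring

/-- The factor `q`. -/
def Q : List V := [(10681,-27072,17647,6256,-6757), (-38415,102606,-79074,20286,13557),
  (-10065,33960,-42360,67620,-12525), (20750,-58980,54080,-44860,1570),
  (7170,-9660,-11700,66060,-19770), (-17904,43248,-23928,-24864,14808),
  (-3260,9456,-8864,7456,-268)]

/-- The transformed form of degree 30. -/
def FT : List ℤ := [155129256193613,-822371692814715,2143290074663895,-2836202274292810,
  9917525407572810,3809117352991320,-100976301080637300,268412354662107600,-429117937115486400,
  347766407296695600,-281906325836597520,733999561538983200,-1448760658577728800,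
  1734201135714240000,-1411541923459003200,843667101052116480,-389612708039520000,
  134795343035923200,-62835130798867200,-23500754860377600,8267472721405440,70732428040550400,
  -84650949391334400,45978590576332800,-17597166621696000,3144621460082688,838866204610560,
  -565069382164480,120818533539840,-8259935600640,2759962542080]

/-- The transformed form of degree 12 (times 64). -/
def HT64 : List ℤ := [-6895936,-141337344,289183488,-261437440,115441920,-249587712,-605349888,
  792354816,-371543040,94392320,5812224,35782656,-6787072]

/-- The transformed form of degree 12. -/
def HT : List ℤ := HT64.map (· / 64)

lemma HT64_eq : HT64 = HT.map (64 * ·) := by decide +kernel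

/-- Constant of the relation. -/
def cA : V := (147252897186684894,-307886660629044835,119455818181392520,146618882626429935,59986186023246655)
/-- Constant of the relation. -/
def cB : V := (97499212860,-203850435910,79088557120,97072799190,39715945750)
/-- Constant of the relation. -/
def cC : V := (35910,-64575,23400,28755,12195)

/-- The square of `q`. -/
def Q2 : List V := pmul Q Q
/-- 144 times the cofactor. -/
def QC144 : List V := padd ((pmul Q2 Q2).map (mulv cA))
  (padd ((pmul (HT.map emb) Q2).map (mulv cB)) ((pmul (HT.map emb) (HT.map emb)).map (mulv cC)))
/-- The cofactor of `q`. -/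
def QC : List V := QC144.map fun a => (a.1 / 144, a.2.1 / 144, a.2.2.1 / 144, a.2.2.2.1 / 144, a.2.2.2.2 / 144)

lemma QC_eq : QC144 = QC.map ((144 : ℤ) • ·) := by decide +kernel
lemma QC_len : QC.length = 25 := by decide +kernel
lemma Q_QC : pmul Q QC = FT.map emb := by decide +kernel
lemma HT_len : HT.length = 13 := by decide +kernel

lemma Dat.phiK_emb (n : ℤ) : D.phiK (emb n) = n := by simp [emb, Dat.phiK]

lemma Dat.rel1 (s w : ℤ) (hw : w ≠ 0) :
    D.phi (evhV Q s w) * D.phi (evhV QC s w) = ((evh FT s w : ℤ) : 𝓞 K) := by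
  have hw' : (w : K) ≠ 0 := by exact_mod_cast hw
  apply RingOfIntegers.coe_injective
  have h1 := D.ev1_evh Q s w hw
  have h2 := D.ev1_evh QC s w hw
  have h3 := D.ev1_evh (FT.map emb) s w hw
  rw [← Q_QC, D.ev1_pmul, Q_QC, evhV_emb, D.phiK_emb] at h3
  rw [QC_len] at h2
  have l1 : Q.length = 7 := rfl
  have l3 : (FT.map emb).length = 31 := rfl
  rw [l1] at h1
  rw [l3] at h3
  simp only [map_mul, D.coe_phi, map_intCast]
  have : (w : K) ^ 2 * (D.phiK (evhV Q s w) * D.phiK (evhV QC s w)) = w ^ 2 * (evh FT s w : ℤ) := by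
    calc _ = (w * D.phiK (evhV Q s w)) * (w * D.phiK (evhV QC s w)) := by ring
      _ = w * (w * ((evh FT s w : ℤ) : K)) := by rw [h1, h2, h3]; ring
      _ = _ := by ring
  exact mul_left_cancel₀ (pow_ne_zero 2 hw') this

lemma Dat.rel2 (s w : ℤ) (hw : w ≠ 0) :
    144 * D.phi (evhV QC s w) = D.phi cA * D.phi (evhV Q s w) ^ 4
      + D.phi cB * (evh HT s w : ℤ) * D.phi (evhV Q s w) ^ 2
      + D.phi cC * ((evh HT s w : ℤ) : 𝓞 K) ^ 2 := by
  have hw' : (w : K) ≠ 0 := by exact_mod_cast hw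
  apply RingOfIntegers.coe_injective
  have h1 := D.ev1_evh Q s w hw
  have h2 := D.ev1_evh QC s w hw
  have h3 := D.ev1_evh (HT.map emb) s w hw
  have h4 : D.ev1 QC144 (s / w) = ((144 : ℤ) : K) * D.ev1 QC (s / w) := by rw [QC_eq, D.ev1_smul]
  rw [QC144, D.ev1_padd, D.ev1_padd, D.ev1_mulv, D.ev1_mulv, D.ev1_mulv, D.ev1_pmul, D.ev1_pmul,
    D.ev1_pmul, Q2, D.ev1_pmul] at h4
  rw [evhV_emb, D.phiK_emb, List.length_map, HT_len] at h3
  rw [QC_len] at h2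
  have l1 : Q.length = 7 := rfl
  rw [l1] at h1
  simp only [map_mul, map_add, map_pow, D.coe_phi, map_intCast, map_ofNat]
  push_cast at h4
  generalize D.ev1 QC (s / w) = X at *
  generalize D.ev1 Q (s / w) = Y at *
  generalize D.ev1 (HT.map emb) (s / w) = Z at *
  have k1 : D.phiK (evhV Q s w) = w ^ 6 * Y := mul_left_cancel₀ hw' (by rw [h1]; ring)
  have k2 : D.phiK (evhV QC s w) = w ^ 24 * X := mul_left_cancel₀ hw' (by rw [h2]; ring)
  have k3 : ((evh HT s w : ℤ) : K) = w ^ 12 * Z := mul_left_cancel₀ hw' (by rw [h3]; ring)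
  rw [k1, k2, k3]
  linear_combination (-(w : K) ^ 24) * h4

lemma cC_inv : mulv cC (-16875,65250,-91500,162750,-32625) = emb (30 ^ 4) := by decide +kernel

end

end C41

namespace C41

/-- Coefficients of `f`. -/
def FL : List ℤ := [
  19683, -590490, -8562105, -45664560, -111307365, -154117890, -442375425,
  -2968196400, -13456775025, -42084331650, -102118323645, -203055076800,
  -323582560425, -408808802250, -459390230325, -577967879520, -844178628375,
  -1119258449550, -1068882324075, -561383751600, 62314471665, 395258830650,
  394892797725, 275540518800, 175903201125, 112283394858, 67302682785, 30539055520,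
  8170447965, 1348449810, 168454745]

/-- Auxiliary. -/
def G3L : List ℤ := [
  1, -90, -3915, -62640, -458055, -1902690, -16384275, -329799600, -4485591675,
  -42084331650, -306354970935, -1827495691200, -8736729131475, -33113512982250,
  -111631825968975, -421338584170080, -1846218660256125, -7343454687497550,
  -21038810784768225, -33149149148228400, 11038821712039755, 210056748219466650,
  629586669947315175, 1317901759664317200, 2524018673944920375, 4833431971385160618,
  8691479425192193955, 11831455823156549280, 9496196837848064655, 4701753763039413810,
  1762096131421298235]

/-- Auxiliary. -/
def G5L : List ℤ := [
  3666244447231292724609375, -21997466683387756347656250, -63792653381824493408203125,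
  -68045496940612792968750000, -33172179758548736572265625,
  -9186142086982727050781250, -5273526012897491455078125, -7076731681823730468750000,
  -6416690361499786376953125, -4013474621772766113281250, -1947752449893951416015625,
  -774593646240234375000000, -246873901691436767578125, -62379272804260253906250,
  -14019477243804931640625, -3527635983398437500000, -1030491489715576171875,
  -273256457409667968750, -52191519730224609375, -5482263199218750000,
  121707952470703125, 154397980722656250, 30850999822265625, 4305320606250000,
  549697503515625, 70177121786250, 8412835348125, 763476388000, 40852239825,
  1348449810, 33690949]

/-- Auxiliary. -/
def G25L : List ℤ := [
  -851968, 81100800, -3741696000, 111953920000, -2465510400000, 43296768000000,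
  -643989312000000, 8465420160000000, -100274112000000000, 1067325396000000000,
  -10058782878000000000, 82561720230000000000, -582014811975000000000,
  3480135698250000000000, -17390734146562500000000, 70871740661250000000000,
  -223396495551562500000000, 461806545691406250000000, -40011655986328125000000,
  -4737366816064453125000000, 25181079413598632812500000, -85148745479003906250000000,
  217106744361877441406250000, -437465041506958007812500000,
  707520178756713867187500000, -921587548926544189453125000,
  963422868490219116210937500, -797961066579818725585937500,
  504770488142967224121093750, -220846685171127319335937500,
  50203426182270050048828125]


lemma evh_mod (L : List ℤ) (n s w : ℤ) : evh L s w % n = evh L (s % n) (w % n) % n := by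
  have h : evh L s w ≡ evh L (s % n) (w % n) [ZMOD n] := by
    induction L with
    | nil => rfl
    | cons c L ih =>
      simp only [evh]
      exact Int.ModEq.add (Int.ModEq.mul rfl (Int.ModEq.pow _ (Int.mod_modEq _ _).symm))
        (Int.ModEq.mul (Int.mod_modEq _ _).symm ih)
  exact h

lemma sq_mod (L : List ℤ) (n u v y : ℤ) (h : y ^ 2 = -evh L u v) :
    ((y % n) ^ 2 + evh L (u % n) (v % n)) % n = 0 := by
  rw [Int.add_emod, ← evh_mod, ← Int.add_emod]
  have : (y % n) ^ 2 ≡ y ^ 2 [ZMOD n] := Int.ModEq.pow _ (Int.mod_modEq _ _)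
  have h2 := this.add_right (evh L u v)
  rw [h] at h2
  rw [h2]
  simp

lemma mem_Ico (n u : ℤ) (hn : 0 < n) : u % n ∈ Finset.Ico 0 n :=
  Finset.mem_Ico.2 ⟨Int.emod_nonneg _ hn.ne', Int.emod_lt_of_pos _ hn⟩

lemma odd_val {p : ℤ} (hp : Prime p) (k : ℕ) {y m : ℤ} (h : y ^ 2 = p ^ (2 * k + 1) * m)
    (hm : ¬ p ∣ m) : False := by
  induction k generalizing y with
  | zero =>
    have : p ∣ y ^ 2 := ⟨m, by rw [h]; ring⟩
    obtain ⟨z, rfl⟩ := hp.dvd_of_dvd_pow this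
    apply hm
    refine ⟨z ^ 2, mul_left_cancel₀ hp.ne_zero ?_⟩
    linear_combination -h
  | succ k ih =>
    have : p ∣ y ^ 2 := ⟨p ^ (2 * k + 2) * m, by rw [h]; ring⟩
    obtain ⟨z, rfl⟩ := hp.dvd_of_dvd_pow this
    apply ih (y := z)
    apply mul_left_cancel₀ (pow_ne_zero 2 hp.ne_zero)
    linear_combination h

lemma dec8 : ∀ a ∈ Finset.Ico (0:ℤ) 8, ∀ b ∈ Finset.Ico (0:ℤ) 8, ∀ c ∈ Finset.Ico (0:ℤ) 8,
    (c ^ 2 + evh FL a b) % 8 = 0 → (a % 2 = 1 ∧ b % 2 = 1) ∨ (a % 2 = 0 ∧ b % 2 = 0) := by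
  decide +kernel

lemma dec9 : ∀ a ∈ Finset.Ico (0:ℤ) 9, ∀ b ∈ Finset.Ico (0:ℤ) 9, ∀ c ∈ Finset.Ico (0:ℤ) 9,
    (c ^ 2 + evh FL a b) % 9 = 0 → a % 3 = 0 ∨ b % 3 = 0 := by
  decide +kernel

lemma dec3 : ∀ a ∈ Finset.Ico (0:ℤ) 3, ∀ b ∈ Finset.Ico (0:ℤ) 3,
    evh G3L a b % 3 = 0 → b = 0 := by
  decide +kernel

lemma dec3' : ∀ a ∈ Finset.Ico (0:ℤ) 3, ∀ b ∈ Finset.Ico (0:ℤ) 3,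
    evh FL a b % 3 = 0 → a = 0 ∨ b ≠ 0 := by
  decide +kernel

lemma dec5 : ∀ a ∈ Finset.Ico (0:ℤ) 5, ∀ b ∈ Finset.Ico (0:ℤ) 5,
    evh G5L a b % 5 = 0 → a = 0 := by
  decide +kernel

lemma dec25 : ∀ a ∈ Finset.Ico (0:ℤ) 5, ∀ b ∈ Finset.Ico (0:ℤ) 5,
    evh G25L a b % 5 = 0 → b = 0 := by
  decide +kernel

lemma dec5' : ∀ a ∈ Finset.Ico (0:ℤ) 5, ∀ b ∈ Finset.Ico (0:ℤ) 5,
    evh FL a b % 5 = 0 → b = 0 ∨ (a + b) % 5 = 0 := by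
  decide +kernel

lemma dec2 : ∀ a ∈ Finset.Ico (0:ℤ) 2, ∀ b ∈ Finset.Ico (0:ℤ) 2,
    evh FT a b % 2 = 0 → b = 0 := by
  decide +kernel

lemma F_3 (u v : ℤ) : evh FL (3 * u) v = 3 ^ 9 * evh G3L u v := by
  simp only [evh, FL, G3L, List.length_cons, List.length_nil]; push_cast; ring

lemma F_5 (u v : ℤ) : evh FL u (5 * v) = 5 * evh G5L u v := by
  simp only [evh, FL, G5L, List.length_cons, List.length_nil]; push_cast; ring

lemma F_25 (s v : ℤ) : evh FL (-v + 5 * s) v = 5 ^ 5 * evh G25L s v := by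
  simp only [evh, FL, G25L, List.length_cons, List.length_nil]; push_cast; ring

lemma F_T (s w : ℤ) : evh FL (-w + 2 * s) (3 * w) = 2 ^ 16 * evh FT s w := by
  simp only [evh, FL, FT, List.length_cons, List.length_nil]; push_cast; ring

lemma not_both {u v p : ℤ} (hp : Prime p) (h : IsCoprime u v) (h1 : p ∣ u) (h2 : p ∣ v) : False :=
  hp.not_isUnit (h.isUnit_of_dvd' h1 h2)

lemma descent {u v y : ℤ} (hc : IsCoprime u v) (h : y ^ 2 = -evh FL u v) :
    ∃ s w y' : ℤ, w % 2 = 1 ∧ u = -w + 2 * s ∧ v = 3 * w ∧ y' ^ 2 = -evh FT s w ∧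
      ¬ (2 ∣ y') ∧ ¬ (3 ∣ y') ∧ ¬ (5 ∣ y') := by
  have p2 : Prime (2 : ℤ) := Int.prime_two
  have p3 : Prime (3 : ℤ) := Int.prime_three
  have p5 : Prime (5 : ℤ) := by norm_num
  have h8 := dec8 _ (mem_Ico 8 u (by norm_num)) _ (mem_Ico 8 v (by norm_num)) _
    (mem_Ico 8 y (by norm_num)) (sq_mod FL 8 u v y h)
  have h9 := dec9 _ (mem_Ico 9 u (by norm_num)) _ (mem_Ico 9 v (by norm_num)) _
    (mem_Ico 9 y (by norm_num)) (sq_mod FL 9 u v y h)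
  have hodd : u % 2 = 1 ∧ v % 2 = 1 := by
    rcases h8 with h8 | h8
    · omega
    · exact (not_both p2 hc (by omega) (by omega)).elim
  have hu3 : ¬ (3 ∣ u) := by
    rintro ⟨u', rfl⟩
    rw [F_3] at h
    refine odd_val p3 4 (y := y) (m := -evh G3L u' v) (by rw [h]; ring) ?_
    rw [Int.dvd_neg]
    intro hd
    have hd' := Int.emod_eq_zero_of_dvd hd
    rw [evh_mod] at hd'
    have := dec3 _ (mem_Ico 3 u' (by norm_num)) _ (mem_Ico 3 v (by norm_num)) hd'
    exact not_both p3 hc (Dvd.intro _ rfl) (Int.dvd_of_emod_eq_zero this)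
  have hv3 : 3 ∣ v := by omega
  have hy5 : ¬ 5 ∣ evh FL u v := by
    intro hd
    have hd' := Int.emod_eq_zero_of_dvd hd
    rw [evh_mod] at hd'
    rcases dec5' _ (mem_Ico 5 u (by norm_num)) _ (mem_Ico 5 v (by norm_num)) hd' with h5 | h5
    · obtain ⟨v', rfl⟩ := Int.dvd_of_emod_eq_zero h5
      rw [F_5] at h
      refine odd_val p5 0 (y := y) (m := -evh G5L u v') (by rw [h]; ring) ?_
      rw [Int.dvd_neg]
      intro hd
      have hd' := Int.emod_eq_zero_of_dvd hd
      rw [evh_mod] at hd'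
      have := dec5 _ (mem_Ico 5 u (by norm_num)) _ (mem_Ico 5 v' (by norm_num)) hd'
      exact not_both p5 hc (Int.dvd_of_emod_eq_zero this) (Dvd.intro _ rfl)
    · have : (u + v) % 5 = 0 := by omega
      obtain ⟨s, hs⟩ := Int.dvd_of_emod_eq_zero this
      obtain rfl : u = -v + 5 * s := by linarith
      rw [F_25] at h
      refine odd_val p5 2 (y := y) (m := -evh G25L s v) (by rw [h]; ring) ?_
      rw [Int.dvd_neg]
      intro hd
      have hd' := Int.emod_eq_zero_of_dvd hd
      rw [evh_mod] at hd'
      have := dec25 _ (mem_Ico 5 s (by norm_num)) _ (mem_Ico 5 v (by norm_num)) hd'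
      have hv := Int.dvd_of_emod_eq_zero this
      exact not_both p5 hc (by omega) hv
  have hy3 : ¬ 3 ∣ evh FL u v := by
    intro hd
    have hd' := Int.emod_eq_zero_of_dvd hd
    rw [evh_mod] at hd'
    have := dec3' _ (mem_Ico 3 u (by norm_num)) _ (mem_Ico 3 v (by norm_num)) hd'
    omega
  obtain ⟨w, rfl⟩ := hv3
  obtain ⟨s, hs⟩ : 2 ∣ u + w := by omega
  obtain rfl : u = -w + 2 * s := by linarith
  rw [F_T] at h hy5 hy3
  have hy : (2 : ℤ) ^ 8 ∣ y := by
    rw [← Int.pow_dvd_pow_iff (n := 2) (by norm_num)]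
    exact ⟨-evh FT s w, by rw [h]; ring⟩
  obtain ⟨y', rfl⟩ := hy
  have h' : y' ^ 2 = -evh FT s w := by
    apply mul_left_cancel₀ (show (2 : ℤ) ^ 16 ≠ 0 by norm_num)
    linear_combination h
  have hF : evh FT s w = -y' ^ 2 := by linarith
  refine ⟨s, w, y', by omega, rfl, rfl, h', ?_, ?_, ?_⟩
  · intro hd
    have hd' : evh FT s w % 2 = 0 := by
      rw [hF]
      exact Int.emod_eq_zero_of_dvd ((Int.dvd_neg).2 (dvd_pow hd two_ne_zero))
    rw [evh_mod] at hd'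
    have := dec2 _ (mem_Ico 2 s (by norm_num)) _ (mem_Ico 2 w (by norm_num)) hd'
    omega
  · intro hd
    apply hy3
    rw [hF]
    exact Dvd.dvd.mul_left ((Int.dvd_neg).2 (dvd_pow hd two_ne_zero)) _
  · intro hd
    apply hy5
    rw [hF]
    exact Dvd.dvd.mul_left ((Int.dvd_neg).2 (dvd_pow hd two_ne_zero)) _

lemma evh_smul (L : List ℤ) (d s w : ℤ) :
    d * evh L (d * s) (d * w) = d ^ L.length * evh L s w := by
  induction L with
  | nil => simp [evh]
  | cons c L ih =>
    simp only [evh, List.length_cons]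
    linear_combination (d * s) * ih

lemma to_coprime {u v y : ℤ} (h0 : (u, v) ≠ (0, 0)) (h : y ^ 2 = -evh FL u v) :
    ∃ u v y : ℤ, IsCoprime u v ∧ y ^ 2 = -evh FL u v := by
  obtain ⟨d, u', v', hd, hc, rfl, rfl⟩ : ∃ d u' v' : ℤ, d ≠ 0 ∧ IsCoprime u' v' ∧
      u = d * u' ∧ v = d * v' := by
    have hg : 0 < Int.gcd u v := by
      rw [Int.gcd_pos_iff]
      by_contra hh
      push Not at hh
      exact h0 (by simp [hh.1, hh.2])
    obtain ⟨u', v', hc, hu, hv⟩ := Int.exists_gcd_one hg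
    exact ⟨Int.gcd u v, u', v', by exact_mod_cast hg.ne', Int.isCoprime_iff_gcd_eq_one.2 hc,
      by rw [mul_comm]; exact hu, by rw [mul_comm]; exact hv⟩
  have e : evh FL (d * u') (d * v') = d ^ 30 * evh FL u' v' := by
    apply mul_left_cancel₀ hd
    rw [evh_smul]
    have : FL.length = 31 := rfl
    rw [this]; ring
  rw [e] at h
  have hy : d ^ 15 ∣ y := by
    rw [← Int.pow_dvd_pow_iff (n := 2) (by norm_num)]
    exact ⟨-evh FL u' v', by rw [h]; ring⟩
  obtain ⟨y', rfl⟩ := hy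
  refine ⟨u', v', y', hc, ?_⟩
  apply mul_left_cancel₀ (pow_ne_zero 30 hd)
  linear_combination h

end C41

namespace C41

/-- Auxiliary. -/
def HL : List ℤ := [
  -81, -324, -1782, -5940, -4455, 7128, 22572, 26136, 31185, 31020, 9834, -804, -1657]

/-- Auxiliary. -/
def GfL : List ℤ := [
  1458, 14580, 0, -277020, -1246590, -2881008, -5909760, -12927600, -27609660,
  -52551720, -71278272, -53618760, -15338700, 3324240, -10177920, -28544688,
  -28175670, -14381100, -6013120, -2236540, -251382]

/-- Auxiliary. -/
def H1L : List ℤ := [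
  -27, -297, -1485, -1485, 2970, 11286, 15246, 20790, 23265, 8195, -737, -1657]

/-- Auxiliary. -/
def H2L : List ℤ := [
  -81, -297, -1485, -4455, -2970, 4158, 11286, 10890, 10395, 7755, 1639, -67]

/-- Auxiliary. -/
def HuuL : List ℤ := [
  -27, -270, -405, 1080, 5130, 8316, 13230, 16920, 6705, -670, -1657]

/-- Auxiliary. -/
def HvvL : List ℤ := [
  -81, -270, -1215, -3240, -1890, 2268, 5130, 3960, 2835, 1410, 149]

/-- Auxiliary. -/
def GuL : List ℤ := [
  729, 0, -41553, -249318, -720252, -1772928, -4524660, -11043864, -23648274,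
  -35639136, -29490318, -9203220, 2160756, -7124544, -21408516, -22540536, -12223935,
  -5411808, -2124713, -251382]

/-- Auxiliary. -/
def GvL : List ℤ := [
  1458, 13851, 0, -235467, -997272, -2160756, -4136832, -8402940, -16565796,
  -28903446, -35639136, -24128442, -6135480, 1163484, -3053376, -7136172, -5635134,
  -2157165, -601312, -111827]

/-- Auxiliary. -/
def BA1 : List ℤ := [
  -938826477, 5106104091, -140674716666, -176748357258, 7245120894, 347840134620,
  336501439296, 336340777234, 329879695167, 78447903809, -3149565078]

/-- Auxiliary. -/
def BB1 : List ℤ := [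
  -9640337841, 37088234469, 86130343332, 32779681044, -288959103840, -400060733358,
  -539231910206, -921827429028, -390839584311, -5386535, 77892975138]

/-- Auxiliary. -/
def BA2 : List ℤ := [
  -10098, -31977, -166617, -464508, -96954, 677886, 1084248, 669548, 714692, 454971,
  -237271]

/-- Auxiliary. -/
def BB2 : List ℤ := [
  3366, 35343, 166617, 93126, -457248, -1197108, -1194622, -1715758, -1765654, 309837,
  365941]


lemma id_u (u v : ℤ) : u * evh FL u v = evh HL u v * evh GvL u v - evh H2L u v * evh GfL u v := by
  simp only [evh, FL, HL, GvL, H2L, GfL, List.length_cons, List.length_nil]; push_cast; ring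

lemma id_v (u v : ℤ) : v * evh FL u v = evh H1L u v * evh GfL u v - evh HL u v * evh GuL u v := by
  simp only [evh, FL, HL, GuL, H1L, GfL, List.length_cons, List.length_nil]; push_cast; ring

lemma id_vv (u v : ℤ) : v ^ 2 * evh GfL u v = evh HL u v * evh HuuL u v - evh H1L u v ^ 2 := by
  simp only [evh, HuuL, HL, H1L, GfL, List.length_cons, List.length_nil]; push_cast; ring

lemma id_uu (u v : ℤ) : u ^ 2 * evh GfL u v = evh HL u v * evh HvvL u v - evh H2L u v ^ 2 := by
  simp only [evh, HvvL, HL, H2L, GfL, List.length_cons, List.length_nil]; push_cast; ring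

lemma bez1 (u v : ℤ) : evh BA1 u v * evh H1L u v + evh BB1 u v * evh H2L u v
    = 2 ^ 16 * 3 ^ 9 * 5 ^ 4 * v ^ 21 := by
  simp only [evh, BA1, BB1, H1L, H2L, List.length_cons, List.length_nil]; push_cast; ring

lemma bez2 (u v : ℤ) : evh BA2 u v * evh H1L u v + evh BB2 u v * evh H2L u v
    = 2 ^ 16 * 3 ^ 2 * 5 ^ 4 * u ^ 21 := by
  simp only [evh, BA2, BB2, H1L, H2L, List.length_cons, List.length_nil]; push_cast; ring

lemma H_T (s w : ℤ) : evh HL (-w + 2 * s) (3 * w) = 64 * evh HT s w := by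
  have : HT = [-107749, -2208396, 4518492, -4084960, 1803780, -3899808, -9458592, 12380544,
    -5805360, 1474880, 90816, 559104, -106048] := by decide +kernel
  rw [this]
  simp only [evh, HL, List.length_cons, List.length_nil]; push_cast; ring

lemma thirty_of (I : Ideal ℤ) [hI : I.IsPrime] {m n k : ℕ} {x : ℤ}
    (h : 2 ^ m * 3 ^ n * 5 ^ k * x ∈ I) : 30 ∈ I ∨ x ∈ I := by
  rcases hI.mem_or_mem h with h | h
  · left
    rcases hI.mem_or_mem h with h | h
    · rcases hI.mem_or_mem h with h | h
      · have := I.mul_mem_left 15 (hI.mem_of_pow_mem _ h)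
        norm_num at this; exact this
      · have := I.mul_mem_left 10 (hI.mem_of_pow_mem _ h)
        norm_num at this; exact this
    · have := I.mul_mem_left 6 (hI.mem_of_pow_mem _ h)
      norm_num at this; exact this
  · exact Or.inr h

lemma core (I : Ideal ℤ) [hI : I.IsPrime] {u v : ℤ} (hc : IsCoprime u v)
    (hh : evh HL u v ∈ I) (hf : evh FL u v ∈ I) : 30 ∈ I := by
  have k1 : evh H1L u v ∈ I := by
    have e : evh H1L u v * evh GfL u v ∈ I := by
      have : evh H1L u v * evh GfL u v = v * evh FL u v + evh HL u v * evh GuL u v := by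
        rw [id_v]; ring
      rw [this]
      exact I.add_mem (I.mul_mem_left _ hf) (I.mul_mem_right _ hh)
    rcases hI.mem_or_mem e with e | e
    · exact e
    · apply hI.mem_of_pow_mem 2
      have : evh H1L u v ^ 2 = evh HL u v * evh HuuL u v - v ^ 2 * evh GfL u v := by
        rw [id_vv]; ring
      rw [this]
      exact I.sub_mem (I.mul_mem_right _ hh) (I.mul_mem_left _ e)
  have k2 : evh H2L u v ∈ I := by
    have e : evh H2L u v * evh GfL u v ∈ I := by
      have : evh H2L u v * evh GfL u v = evh HL u v * evh GvL u v - u * evh FL u v := by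
        rw [id_u]; ring
      rw [this]
      exact I.sub_mem (I.mul_mem_right _ hh) (I.mul_mem_left _ hf)
    rcases hI.mem_or_mem e with e | e
    · exact e
    · apply hI.mem_of_pow_mem 2
      have : evh H2L u v ^ 2 = evh HL u v * evh HvvL u v - u ^ 2 * evh GfL u v := by
        rw [id_uu]; ring
      rw [this]
      exact I.sub_mem (I.mul_mem_right _ hh) (I.mul_mem_left _ e)
  have b1 := I.add_mem (I.mul_mem_left (evh BA1 u v) k1) (I.mul_mem_left (evh BB1 u v) k2)
  have b2 := I.add_mem (I.mul_mem_left (evh BA2 u v) k1) (I.mul_mem_left (evh BB2 u v) k2)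
  rw [bez1] at b1
  rw [bez2] at b2
  rcases thirty_of I b1 with b1 | b1
  · exact b1
  rcases thirty_of I b2 with b2 | b2
  · exact b2
  obtain ⟨a, b, hab⟩ := hc
  have := I.add_mem (I.mul_mem_left a (hI.mem_of_pow_mem _ b2))
    (I.mul_mem_left b (hI.mem_of_pow_mem _ b1))
  rw [hab] at this
  exact (hI.ne_top ((Ideal.eq_top_iff_one _).2 this)).elim

section
variable {K : Type} [Field K] [NumberField K] (D : Dat K)
open NumberField

lemma Dat.coprime_q {s w y : ℤ} (hw : w ≠ 0) (hc : IsCoprime (-w + 2 * s) (3 * w))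
    (hy : y ^ 2 = -evh FT s w) (hy30 : IsCoprime y 30) :
    IsCoprime (D.phi (evhV Q s w)) (-D.phi (evhV QC s w)) := by
  have := D.pid
  have r1 := D.rel1 s w hw
  have r2 := D.rel2 s w hw
  have hF : ((evh FT s w : ℤ) : 𝓞 K) = -((y : ℤ) : 𝓞 K) ^ 2 := by
    have : evh FT s w = -y ^ 2 := by linarith
    rw [this]; push_cast; ring
  have key : ∀ π : 𝓞 K, Prime π → π ∣ D.phi (evhV Q s w) → π ∣ D.phi (evhV QC s w) → False := by
    intro π hπ h1 h2
    set J : Ideal (𝓞 K) := Ideal.span {π} with hJ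
    have hJp : J.IsPrime := (Ideal.span_singleton_prime hπ.ne_zero).2 hπ
    set I : Ideal ℤ := J.comap (Int.castRingHom (𝓞 K)) with hI
    have hIp : I.IsPrime := Ideal.comap_isPrime _ _
    have mem : ∀ n : ℤ, n ∈ I ↔ π ∣ (n : 𝓞 K) := fun n => by
      rw [hI, Ideal.mem_comap, hJ, Ideal.mem_span_singleton]; simp
    have hyI : y ∈ I := by
      rw [mem]
      apply hπ.dvd_of_dvd_pow (n := 2)
      rw [← dvd_neg, ← hF, ← r1]
      exact h1.mul_right _
    have hFI : evh FT s w ∈ I := by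
      have : evh FT s w = -y ^ 2 := by linarith
      rw [this]
      exact I.neg_mem (I.pow_mem_of_mem hyI 2 (by norm_num))
    have h30 : (30 : ℤ) ∈ I := by
      have hd : π ∣ D.phi cC * ((evh HT s w : ℤ) : 𝓞 K) ^ 2 := by
        have e : D.phi cC * ((evh HT s w : ℤ) : 𝓞 K) ^ 2 = 144 * D.phi (evhV QC s w)
            - D.phi (evhV Q s w) * (D.phi cA * D.phi (evhV Q s w) ^ 3
              + D.phi cB * (evh HT s w : ℤ) * D.phi (evhV Q s w)) := by
          rw [r2]; ring
        rw [e]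
        exact dvd_sub (h2.mul_left _) (h1.mul_right _)
      rcases hπ.dvd_or_dvd hd with hd | hd
      · apply hIp.mem_of_pow_mem 4
        rw [mem]
        have := congrArg D.phi cC_inv
        rw [D.phi_mul] at this
        have e : D.phi (emb (30 ^ 4)) = ((30 ^ 4 : ℤ) : 𝓞 K) := D.phi_int _
        rw [e] at this
        rw [← this]
        exact hd.mul_right _
      · have hH : evh HT s w ∈ I := (mem _).2 (hπ.dvd_of_dvd_pow hd)
        apply core I hc
        · rw [H_T]; exact I.mul_mem_left _ hH
        · rw [F_T]; exact I.mul_mem_left _ hFI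
    obtain ⟨a, b, hab⟩ := hy30
    have := I.add_mem (I.mul_mem_left a hyI) (I.mul_mem_left b h30)
    rw [hab] at this
    exact hIp.ne_top ((Ideal.eq_top_iff_one _).2 this)
  apply isCoprime_of_prime_dvd
  · rintro ⟨h1, h2⟩
    rw [neg_eq_zero] at h2
    rw [h1, zero_mul] at r1
    rw [hF] at r1
    have : (y : 𝓞 K) ^ 2 = 0 := by linear_combination r1
    have y0 : y = 0 := by exact_mod_cast pow_eq_zero_iff (two_ne_zero) |>.1 this
    subst y0
    rw [isCoprime_zero_left, Int.isUnit_iff] at hy30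
    omega
  · intro π hπ h1 h2
    exact key π hπ h1 ((dvd_neg).1 h2)

lemma Dat.q_form (D : Dat K) {s w y : ℤ} (hw : w ≠ 0) (hc : IsCoprime (-w + 2 * s) (3 * w))
    (hy : y ^ 2 = -evh FT s w) (hy30 : IsCoprime y 30) :
    ∃ t z, evhV Q s w = mulv (epsv t) (mulv z z) := by
  have := D.pid
  have hco := D.coprime_q hw hc hy hy30
  have r1 := D.rel1 s w hw
  have hF : ((evh FT s w : ℤ) : 𝓞 K) = -((y : ℤ) : 𝓞 K) ^ 2 := by
    have : evh FT s w = -y ^ 2 := by linarith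
    rw [this]; push_cast; ring
  have hm : D.phi (evhV Q s w) * (-D.phi (evhV QC s w)) = (y : 𝓞 K) ^ 2 := by
    linear_combination -r1 - hF
  obtain ⟨d, x, hx⟩ := exists_associated_pow_of_mul_eq_pow' hco hm
  obtain ⟨t, ω, hω⟩ := D.unit_rep x
  obtain ⟨z, hz⟩ := D.surj (d * ω)
  refine ⟨t, z, D.phi_inj ?_⟩
  rw [D.phi_mul, D.phi_mul, ← hz, ← D.epsU_coe, ← hx, hω]
  push_cast
  ring

end

end C41

namespace C41

/-- Possible residues of `q` modulo 8. -/
def tg : List V := [(7,2,5,6,1), (3,4,3,4,5)]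

lemma dec10 : ∀ a ∈ Finset.Ico (0:ℤ) 8, ∀ b ∈ Finset.Ico (0:ℤ) 8, ∀ c ∈ Finset.Ico (0:ℤ) 8,
    (c ^ 2 + evh FT a b) % 8 = 0 → b % 2 = 1 → ∃ t ∈ tg,
      evh (Q.map (·.1)) a b % 8 = t.1 ∧ evh (Q.map (·.2.1)) a b % 8 = t.2.1 ∧
      evh (Q.map (·.2.2.1)) a b % 8 = t.2.2.1 ∧ evh (Q.map (·.2.2.2.1)) a b % 8 = t.2.2.2.1 ∧
      evh (Q.map (·.2.2.2.2)) a b % 8 = t.2.2.2.2 := by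
  decide +kernel

/-- Congruence of coordinate vectors. -/
def cg (n : ℤ) (a b : V) : Prop := a.1 ≡ b.1 [ZMOD n] ∧ a.2.1 ≡ b.2.1 [ZMOD n] ∧
  a.2.2.1 ≡ b.2.2.1 [ZMOD n] ∧ a.2.2.2.1 ≡ b.2.2.2.1 [ZMOD n] ∧ a.2.2.2.2 ≡ b.2.2.2.2 [ZMOD n]

instance (n : ℤ) (a b : V) : Decidable (cg n a b) := by unfold cg; infer_instance

lemma cg_iff (n : ℤ) (a b : V) : cg n a b ↔ ∃ k : V, a = b + n • k := by
  constructor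
  · rintro ⟨h0, h1, h2, h3, h4⟩
    obtain ⟨k0, h0⟩ := h0.symm.dvd
    obtain ⟨k1, h1⟩ := h1.symm.dvd
    obtain ⟨k2, h2⟩ := h2.symm.dvd
    obtain ⟨k3, h3⟩ := h3.symm.dvd
    obtain ⟨k4, h4⟩ := h4.symm.dvd
    refine ⟨(k0, k1, k2, k3, k4), ?_⟩
    ext <;> simp <;> linarith
  · rintro ⟨k, rfl⟩
    simp [cg, Int.modEq_iff_dvd]

lemma mulv_add (a b c : V) : mulv a (b + c) = mulv a b + mulv a c := by
  obtain ⟨a0, a1, a2, a3, a4⟩ := a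
  obtain ⟨b0, b1, b2, b3, b4⟩ := b
  obtain ⟨c0, c1, c2, c3, c4⟩ := c
  simp only [mulv, Prod.mk_add_mk]
  ext <;> simp only <;> ring

lemma mulv_smul (n : ℤ) (a b : V) : mulv a (n • b) = n • mulv a b := by
  obtain ⟨a0, a1, a2, a3, a4⟩ := a
  obtain ⟨b0, b1, b2, b3, b4⟩ := b
  simp only [mulv, Prod.smul_mk, smul_eq_mul]
  ext <;> simp only <;> ring

lemma mulv_comm (a b : V) : mulv a b = mulv b a := by
  obtain ⟨a0, a1, a2, a3, a4⟩ := a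
  obtain ⟨b0, b1, b2, b3, b4⟩ := b
  simp only [mulv]
  ext <;> simp only <;> ring

lemma mulv_assoc (a b c : V) : mulv (mulv a b) c = mulv a (mulv b c) := by
  obtain ⟨K, _, _, ⟨D⟩⟩ := exists_dat
  apply D.phi_inj
  simp only [D.phi_mul]
  ring

/-- Reduction of coordinates. -/
def red (n : ℤ) (a : V) : V := (a.1 % n, a.2.1 % n, a.2.2.1 % n, a.2.2.2.1 % n, a.2.2.2.2 % n)

lemma red_eq (n : ℤ) (a : V) : ∃ k : V, a = red n a + n • k := by
  rw [← cg_iff]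
  refine ⟨?_, ?_, ?_, ?_, ?_⟩ <;> exact (Int.mod_modEq _ _).symm

lemma dec_sq : ∀ a ∈ Finset.Ico (0:ℤ) 4, ∀ b ∈ Finset.Ico (0:ℤ) 4, ∀ c ∈ Finset.Ico (0:ℤ) 4,
    ∀ d ∈ Finset.Ico (0:ℤ) 4, ∀ e ∈ Finset.Ico (0:ℤ) 4, ∀ t, ∀ q ∈ tg,
    ¬ cg 8 (mulv (epsv t) q) (mulv (a,b,c,d,e) (a,b,c,d,e)) := by
  decide +kernel

lemma no_q {s w y : ℤ} (hw : w % 2 = 1) (hy : y ^ 2 = -evh FT s w)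
    {t : Fin 2 × Fin 2 × Fin 2} {z : V} (h : evhV Q s w = mulv (epsv t) (mulv z z)) : False := by
  obtain ⟨q, hq, hq'⟩ : ∃ q ∈ tg, cg 8 (evhV Q s w) q := by
    obtain ⟨q, hq, e0, e1, e2, e3, e4⟩ := dec10 _ (mem_Ico 8 s (by norm_num)) _
      (mem_Ico 8 w (by norm_num)) _ (mem_Ico 8 y (by norm_num)) (sq_mod FT 8 s w y hy) (by omega)
    have hr : ∀ q ∈ tg, red 8 q = q := by decide
    have hr := hr q hq
    refine ⟨q, hq, ?_⟩
    simp only [red, Prod.ext_iff] at hr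
    obtain ⟨r0, r1, r2, r3, r4⟩ := hr
    rw [← evh_mod] at e0 e1 e2 e3 e4
    refine ⟨?_, ?_, ?_, ?_, ?_⟩
    · rw [evhV_0]; exact e0.trans r0.symm
    · rw [evhV_1]; exact e1.trans r1.symm
    · rw [evhV_2]; exact e2.trans r2.symm
    · rw [evhV_3]; exact e3.trans r3.symm
    · rw [evhV_4]; exact e4.trans r4.symm
  obtain ⟨k, hk⟩ := (cg_iff _ _ _).1 hq'
  set Z := mulv (epsv t) z with hZ
  have h1 : mulv (epsv t) (evhV Q s w) = mulv Z Z := by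
    rw [h, hZ, mulv_assoc, ← mulv_assoc z, mulv_comm z (epsv t), mulv_assoc (epsv t) z z]
  obtain ⟨m, hm⟩ := red_eq 4 Z
  refine dec_sq _ (mem_Ico 4 Z.1 (by norm_num)) _ (mem_Ico 4 Z.2.1 (by norm_num)) _
    (mem_Ico 4 Z.2.2.1 (by norm_num)) _ (mem_Ico 4 Z.2.2.2.1 (by norm_num)) _
    (mem_Ico 4 Z.2.2.2.2 (by norm_num)) t q hq ?_
  change cg 8 _ (mulv (red 4 Z) (red 4 Z))
  generalize red 4 Z = r at hm
  rw [cg_iff]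
  refine ⟨mulv r m + 2 • mulv m m - mulv (epsv t) k, ?_⟩
  rw [hk, mulv_add, mulv_smul, hm, mulv_add, mulv_smul, mulv_comm (r + _) r,
    mulv_comm (r + _) m, mulv_add, mulv_add, mulv_smul, mulv_smul, mulv_comm m r] at h1
  rw [← eq_sub_iff_add_eq] at h1
  rw [h1]
  module

theorem no_sol {u v y : ℤ} (h0 : (u, v) ≠ (0, 0)) (h : y ^ 2 = -evh FL u v) : False := by
  obtain ⟨u, v, y, hc, h⟩ := to_coprime h0 h
  obtain ⟨s, w, y, hw, rfl, rfl, h, h2, h3, h5⟩ := descent hc h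
  obtain ⟨K, _, _, ⟨D⟩⟩ := exists_dat
  have c2 : IsCoprime y 2 := ((Int.prime_two.coprime_iff_not_dvd).2 h2).symm
  have c3 : IsCoprime y 3 := ((Int.prime_three.coprime_iff_not_dvd).2 h3).symm
  have c5 : IsCoprime y 5 :=
    (((show Prime (5 : ℤ) by norm_num).coprime_iff_not_dvd).2 h5).symm
  have c30 : IsCoprime y 30 := by
    have := (c2.mul_right c3).mul_right c5
    norm_num at this
    exact this
  obtain ⟨t, z, hz⟩ := D.q_form (by rintro rfl; omega) hc h c30
  exact no_q hw h hz

end C41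

namespace C41

/-- Auxiliary. -/
def HuvL : List ℤ := [
  -27, -270, -1215, -1080, 1890, 6156, 6930, 7560, 6345, 1490, -67]

/-- First variable. -/
noncomputable abbrev xx : MvPolynomial (Fin 2) ℚ := X 0
/-- Second variable. -/
noncomputable abbrev yy : MvPolynomial (Fin 2) ℚ := X 1

lemma pd_int (i : Fin 2) (c : ℤ) : pderiv i ((c : ℤ) : MvPolynomial (Fin 2) ℚ) = 0 :=
  Derivation.map_intCast _ _

/-- Derivative in the first variable. -/
lemma pd0_evh (c : ℤ) (L : List ℤ) : pderiv 0 (evh (c :: L) xx yy)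
    = evh L xx yy + xx * pderiv 0 (evh L xx yy) := by
  simp only [evh, map_add, Derivation.leibniz, Derivation.leibniz_pow, pd_int,
    pderiv_X_self, pderiv_X_of_ne (show (1 : Fin 2) ≠ 0 by decide), smul_eq_mul]
  simp
  ring

lemma pd1_evh (c : ℤ) (L : List ℤ) : pderiv 1 (evh (c :: L) xx yy)
    = (c : MvPolynomial (Fin 2) ℚ) * (L.length * yy ^ (L.length - 1))
      + xx * pderiv 1 (evh L xx yy) := by
  simp only [evh, map_add, Derivation.leibniz, Derivation.leibniz_pow, pd_int,
    pderiv_X_self, pderiv_X_of_ne (show (0 : Fin 2) ≠ 1 by decide), smul_eq_mul]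
  simp

lemma pd_nil (i : Fin 2) : pderiv i (evh ([] : List ℤ) xx yy) = 0 := by simp [evh]

/-- Coefficients of `h`. -/
def hco : Fin 13 → ℤ := ![-81, -324, -1782, -5940, -4455, 7128, 22572, 26136, 31185, 31020, 9834,
  -804, -1657]

lemma hco_eq (i : Fin 13) : (Nat.choose 12 i : ℚ) * alphaC41 i = (hco i : ℤ) := by
  fin_cases i <;> simp [alphaC41, hco, Nat.choose] <;> norm_num

lemma h_eq : hC41 = evh HL xx yy := by
  unfold hC41
  simp only [hco_eq, map_intCast]
  simp only [Fin.sum_univ_succ, hco, evh, HL, List.length_cons, List.length_nil]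
  simp
  ring

lemma h_0 : pderiv 0 (evh HL xx yy) = 12 * evh H1L xx yy := by
  simp only [HL, H1L, pd0_evh, pd_nil]
  simp only [evh, List.length_cons, List.length_nil]; push_cast; ring

lemma h_1 : pderiv 1 (evh HL xx yy) = 12 * evh H2L xx yy := by
  simp only [HL, H2L, pd1_evh, pd_nil]
  simp only [evh, List.length_cons, List.length_nil]; push_cast; ring

lemma h_00 : pderiv 0 (evh H1L xx yy) = 11 * evh HuuL xx yy := by
  simp only [HuuL, H1L, pd0_evh, pd_nil]
  simp only [evh, List.length_cons, List.length_nil]; push_cast; ring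

lemma h_01 : pderiv 1 (evh H1L xx yy) = 11 * evh HuvL xx yy := by
  simp only [HuvL, H1L, pd1_evh, pd_nil]
  simp only [evh, List.length_cons, List.length_nil]; push_cast; ring

lemma h_11 : pderiv 1 (evh H2L xx yy) = 11 * evh HvvL xx yy := by
  simp only [HvvL, H2L, pd1_evh, pd_nil]
  simp only [evh, List.length_cons, List.length_nil]; push_cast; ring

lemma g_0 : pderiv 0 (evh GfL xx yy) = 20 * evh GuL xx yy := by
  simp only [GfL, GuL, pd0_evh, pd_nil]
  simp only [evh, List.length_cons, List.length_nil]; push_cast; ring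

lemma g_1 : pderiv 1 (evh GfL xx yy) = 20 * evh GvL xx yy := by
  simp only [GfL, GvL, pd1_evh, pd_nil]
  simp only [evh, List.length_cons, List.length_nil]; push_cast; ring

lemma pd_smul (i : Fin 2) (n : ℕ) [n.AtLeastTwo] (p : MvPolynomial (Fin 2) ℚ) :
    pderiv i (OfNat.ofNat n * p) = OfNat.ofNat n * pderiv i p := by
  rw [← map_ofNat (C : ℚ →+* MvPolynomial (Fin 2) ℚ) n, pderiv_C_mul]

lemma hess {R : Type} [CommRing R] (x y : R) :
    evh HuuL x y * evh HvvL x y - evh HuvL x y ^ 2 = evh GfL x y := by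
  simp only [evh, HuuL, HvvL, HuvL, GfL, List.length_cons, List.length_nil]; push_cast; ring

lemma jac {R : Type} [CommRing R] (x y : R) :
    evh H1L x y * evh GvL x y - evh H2L x y * evh GuL x y = evh FL x y := by
  simp only [evh, H1L, H2L, GvL, GuL, FL, List.length_cons, List.length_nil]; push_cast; ring

lemma C_inv (n : ℕ) [n.AtLeastTwo] :
    (C (1 / OfNat.ofNat n) : MvPolynomial (Fin 2) ℚ) * OfNat.ofNat n = 1 := by
  rw [← map_ofNat (C : ℚ →+* MvPolynomial (Fin 2) ℚ) n, ← C_mul]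
  have : (OfNat.ofNat n : ℚ) ≠ 0 := OfNat.ofNat_ne_zero n
  rw [one_div, inv_mul_cancel₀ this, C_1]

lemma g_eq : gC41 = evh GfL xx yy := by
  rw [gC41, h_eq, h_0, h_1, pd_smul, pd_smul, pd_smul, h_00, h_01, h_11, ← hess]
  have e : (C (1 / 132 ^ 2) : MvPolynomial (Fin 2) ℚ) * 17424 = 1 := by
    rw [show (1 / 132 ^ 2 : ℚ) = 1 / 17424 by norm_num]
    exact C_inv 17424
  linear_combination (evh HuuL xx yy * evh HvvL xx yy - evh HuvL xx yy ^ 2) * e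

lemma f_eq : fC41 = evh FL xx yy := by
  rw [fC41, h_eq, g_eq, h_0, h_1, g_0, g_1, ← jac]
  have e : (C (1 / 240) : MvPolynomial (Fin 2) ℚ) * 240 = 1 := C_inv 240
  linear_combination (evh H1L xx yy * evh GvL xx yy - evh H2L xx yy * evh GuL xx yy) * e

lemma evh_hom (L : List ℤ) (n : ℕ) (h : L.length = n + 1) : (evh L xx yy).IsHomogeneous n := by
  induction L generalizing n with
  | nil => simp at h
  | cons c L ih =>
    have hl : L.length = n := by simpa using h
    rw [evh, hl]
    refine IsHomogeneous.add ?_ ?_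
    · have h1 : (((c : ℤ) : MvPolynomial (Fin 2) ℚ)).IsHomogeneous 0 := by
        rw [← map_intCast (C : ℚ →+* MvPolynomial (Fin 2) ℚ)]
        exact isHomogeneous_C _ _
      have := h1.mul ((isHomogeneous_X ℚ (1 : Fin 2)).pow n)
      simpa using this
    · cases n with
      | zero =>
        obtain rfl : L = [] := List.length_eq_zero_iff.1 hl
        simp only [evh, mul_zero]
        exact isHomogeneous_zero _ _ _
      | succ m =>
        have := (isHomogeneous_X ℚ (0 : Fin 2)).mul (ih m hl)
        rwa [add_comm] at this

end C41

/-- The form `f` is homogeneous of degree 30 with integer coefficients, and the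
genus-14 hyperelliptic curve `C_41 : y² = -f(u,v)` has no rational points. -/
theorem rational_points_C41 :
    fC41.IsHomogeneous 30 ∧
    (∀ m : Fin 2 →₀ ℕ, ∃ z : ℤ, coeff m fC41 = (z : ℚ)) ∧
    ¬ ∃ u v y : ℤ, (u, v) ≠ (0, 0) ∧
        (y : ℚ) ^ 2 = -eval ![(u : ℚ), (v : ℚ)] fC41 := by
  refine ⟨?_, ?_, ?_⟩
  · rw [C41.f_eq]
    exact C41.evh_hom _ 30 rfl
  · intro m
    refine ⟨coeff m (C41.evh C41.FL (X 0 : MvPolynomial (Fin 2) ℤ) (X 1)), ?_⟩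
    have := C41.evh_map (MvPolynomial.map (Int.castRingHom ℚ)) C41.FL
      (X 0 : MvPolynomial (Fin 2) ℤ) (X 1)
    rw [map_X, map_X] at this
    rw [C41.f_eq, C41.xx, C41.yy, ← this, coeff_map]
    rfl
  · rintro ⟨u, v, y, h0, h⟩
    have e := C41.evh_map (eval ![(u : ℚ), (v : ℚ)]) C41.FL C41.xx C41.yy
    rw [C41.f_eq, e] at h
    simp only [eval_X, Matrix.cons_val_zero, Matrix.cons_val_one] at h
    rw [← C41.evh_cast] at h
    exact C41.no_sol (u := u) (v := v) (y := y) h0 (by exact_mod_cast h)
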